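/- arXiv:1505.03576 — 4 statements merged into one kernel-verified Lean document; each statement's English description precedes it below -/
import Mathlib

section
/- Let n ≥ 2 and m ≥ 1 be integers. For every integer j with 0 ≤ j ≤ 2n − 2 there exist polynomials p, q, r over ℂ with q of degree n, deg p ≤ n, and r of degree m, such that the set {z ∈ ℂ | r(conj(z)) · q(z) = p(z)} is finite and has exactly n + m − 2 + 2j elements. In particular, the set of possible numbers of zeros of harmonically splitting lens type polynomials in L^{hs}(n+m; n, m) includes {n+m−2, n+m, n+m+2, ..., 5n+m−6}. -/
open Filter Topology

theorem isInvertible_smul_id_add_smul_conj {α β : ℂ} (h : ‖α‖ ≠ ‖β‖) :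
    (α • ContinuousLinearMap.id ℝ ℂ + β • (Complex.conjCLE : ℂ →L[ℝ] ℂ)).IsInvertible := by
  set L := α • ContinuousLinearMap.id ℝ ℂ + β • (Complex.conjCLE : ℂ →L[ℝ] ℂ) with hL
  have hker : Function.Injective L := by
    rw [injective_iff_map_eq_zero]
    intro v hv
    by_contra hv0
    have h1 : α * v = -(β * (starRingEnd ℂ) v) := by
      rw [← sub_eq_zero, sub_neg_eq_add]
      simpa [hL] using hv
    have h2 := congrArg norm h1
    rw [norm_neg, norm_mul, norm_mul, RCLike.norm_conj] at h2
    exact h (mul_right_cancel₀ (norm_ne_zero_iff.mpr hv0) h2)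
  exact ⟨(LinearEquiv.ofInjectiveEndo (L : ℂ →ₗ[ℝ] ℂ) hker).toContinuousLinearEquiv, by
    ext; simp⟩

theorem fderiv_slice {F : ℝ × ℂ → ℂ} (hF : ContDiff ℝ 1 F) (v : ℝ × ℂ) :
    fderiv ℝ (fun z => F (v.1, z)) v.2 = fderiv ℝ F v ∘L .inr ℝ ℝ ℂ := by
  have h : HasFDerivAt F (fderiv ℝ F v) (v.1, v.2) :=
    (hF.differentiable one_ne_zero v).hasFDerivAt
  exact (h.comp v.2 (hasFDerivAt_prodMk_right v.1 v.2)).fderiv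

theorem exists_zero_branch {F : ℝ × ℂ → ℂ} (hF : ContDiff ℝ 1 F) {s : ℂ} (hs : F (0, s) = 0)
    (hreg : (fderiv ℝ (fun z => F (0, z)) s).IsInvertible) :
    ∃ ψ : ℝ → ℂ, Tendsto ψ (𝓝 0) (𝓝 s) ∧ (∀ᶠ ε in 𝓝 0, F (ε, ψ ε) = 0) ∧
      ∀ᶠ v in 𝓝 ((0 : ℝ), s), F v = 0 → ψ v.1 = v.2 ∧
        (fderiv ℝ (fun z => F (v.1, z)) v.2).IsInvertible := by
  have hd : HasStrictFDerivAt F (fderiv ℝ F (0, s)) (0, s) :=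
    hF.contDiffAt.hasStrictFDerivAt one_ne_zero
  have hinv : (fderiv ℝ F (0, s) ∘L .inr ℝ ℝ ℂ).IsInvertible := by
    rwa [← fderiv_slice hF (0, s)]
  refine ⟨hd.implicitFunctionOfProdDomain hinv, hd.tendsto_implicitFunctionOfProdDomain hinv,
    by simpa [hs] using hd.eventually_apply_implicitFunctionOfProdDomain hinv, ?_⟩
  have hopen : ∀ᶠ v in 𝓝 ((0 : ℝ), s), (fderiv ℝ F v ∘L .inr ℝ ℝ ℂ).IsInvertible := by
    have hc : Continuous fun v => fderiv ℝ F v ∘L .inr ℝ ℝ ℂ :=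
      (hF.continuous_fderiv one_ne_zero).clm_comp continuous_const
    exact hc.continuousAt.eventually (ContinuousLinearEquiv.isOpen.mem_nhds hinv)
  filter_upwards [hd.eventually_apply_eq_iff_implicitFunctionOfProdDomain hinv, hopen]
    with v hv hv' hv0
  exact ⟨hv.mp (hv0.trans hs.symm), by rwa [fderiv_slice hF v]⟩

theorem eventually_ncard_zeros_eq {F : ℝ × ℂ → ℂ} (hF : ContDiff ℝ 1 F) {K : Set ℂ}
    (hK : IsCompact K) {S : Set ℂ} (hfin : S.Finite) (hS : ∀ z ∈ K, F (0, z) = 0 ↔ z ∈ S)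
    (hSK : S ⊆ interior K)
    (hreg : ∀ s ∈ S, (fderiv ℝ (fun z => F (0, z)) s).IsInvertible) :
    ∀ᶠ ε in 𝓝 (0 : ℝ), {z ∈ K | F (ε, z) = 0}.Finite ∧
      {z ∈ K | F (ε, z) = 0}.ncard = S.ncard ∧
      ∀ z ∈ K, F (ε, z) = 0 → (fderiv ℝ (fun w => F (ε, w)) z).IsInvertible := by
  have hbr : ∀ s, ∃ ψ : ℝ → ℂ, s ∈ S → Tendsto ψ (𝓝 0) (𝓝 s) ∧ (∀ᶠ ε in 𝓝 0, F (ε, ψ ε) = 0) ∧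
      ∀ᶠ v in 𝓝 ((0 : ℝ), s), F v = 0 → ψ v.1 = v.2 ∧
        (fderiv ℝ (fun z => F (v.1, z)) v.2).IsInvertible := fun s => by
    by_cases hs : s ∈ S
    · obtain ⟨ψ, h⟩ := exists_zero_branch hF
        ((hS s (interior_subset (hSK hs))).mpr hs) (hreg s hs)
      exact ⟨ψ, fun _ => h⟩
    · exact ⟨0, fun h => absurd h hs⟩
  choose ψ hψ using hbr
  have hnear : ∀ᶠ ε in 𝓝 (0 : ℝ), ∀ z ∈ K, F (ε, z) = 0 → (∃ s ∈ S, ψ s ε = z) ∧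
      (fderiv ℝ (fun w => F (ε, w)) z).IsInvertible := by
    refine hK.eventually_forall_of_forall_eventually fun z hz => ?_
    by_cases hzS : z ∈ S
    · filter_upwards [(hψ z hzS).2.2] with v hv h0
      exact ⟨⟨z, hzS, (hv h0).1⟩, (hv h0).2⟩
    · have hne : F (0, z) ≠ 0 := fun h => hzS ((hS z hz).mp h)
      filter_upwards [hF.continuous.continuousAt.eventually_ne hne] with v hv h0
      exact absurd h0 hv
  have hzero : ∀ᶠ ε in 𝓝 (0 : ℝ), ∀ s ∈ S, F (ε, ψ s ε) = 0 ∧ ψ s ε ∈ K :=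
    (eventually_all_finite hfin).mpr fun s hs => (hψ s hs).2.1.and
      ((hψ s hs).1.eventually (mem_interior_iff_mem_nhds.mp (hSK hs)))
  have hinj : ∀ᶠ ε in 𝓝 (0 : ℝ), ∀ s ∈ S, ∀ t ∈ S, s ≠ t → ψ s ε ≠ ψ t ε :=
    (eventually_all_finite hfin).mpr fun s hs => (eventually_all_finite hfin).mpr fun t ht => by
      by_cases hst : s = t
      · exact Eventually.of_forall fun _ h => absurd hst h
      · filter_upwards [((hψ s hs).1.prodMk_nhds (hψ t ht).1).eventually
          ((isOpen_ne_fun continuous_fst continuous_snd).mem_nhds hst)] with ε h _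
        exact h
  filter_upwards [hnear, hzero, hinj] with ε h1 h2 h3
  have himg : {z ∈ K | F (ε, z) = 0} = (fun s => ψ s ε) '' S := by
    ext z
    constructor
    · rintro ⟨hz, h0⟩
      exact (h1 z hz h0).1
    · rintro ⟨s, hs, rfl⟩
      exact ⟨(h2 s hs).2, (h2 s hs).1⟩
  refine ⟨himg ▸ hfin.image _, ?_, fun z hz h0 => (h1 z hz h0).2⟩
  rw [himg, Set.InjOn.ncard_image]
  intro s hs t ht hst
  by_contra hne
  exact h3 s hs t ht hne hst

/-- The harmonically splitting lens type map `z ↦ r(conj z) q(z) - p(z)`. -/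
noncomputable def lensMap (p q r : Polynomial ℂ) (z : ℂ) : ℂ :=
  r.eval (starRingEnd ℂ z) * q.eval z - p.eval z

/-- `f` has exactly `c` zeros, all of them nondegenerate. -/
def HasRegularZeros (f : ℂ → ℂ) (c : ℕ) : Prop :=
  {z | f z = 0}.Finite ∧ {z | f z = 0}.ncard = c ∧
    ∀ z, f z = 0 → (fderiv ℝ f z).IsInvertible

theorem HasFDerivAt.isInvertible_fderiv {f : ℂ → ℂ} {z α β : ℂ}
    (hf : HasFDerivAt f
      (α • ContinuousLinearMap.id ℝ ℂ + β • (Complex.conjCLE : ℂ →L[ℝ] ℂ)) z)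
    (h : ‖α‖ ≠ ‖β‖) : (fderiv ℝ f z).IsInvertible :=
  hf.fderiv ▸ isInvertible_smul_id_add_smul_conj h

theorem isInvertible_smul_id {c : ℂ} (hc : c ≠ 0) :
    (c • ContinuousLinearMap.id ℝ ℂ).IsInvertible := by
  have h := isInvertible_smul_id_add_smul_conj (α := c) (β := 0) (by simpa using hc)
  convert h using 1
  ext
  simp

theorem isInvertible_fderiv_rescale {G : ℂ → ℂ} {k a b : ℂ} (hk : k ≠ 0) (hb : b ≠ 0) {z : ℂ}
    (hG : (fderiv ℝ G (b * (z - a))).IsInvertible) (hd : DifferentiableAt ℝ G (b * (z - a))) :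
    (fderiv ℝ (fun z => k * G (b * (z - a))) z).IsInvertible := by
  have h1 : HasFDerivAt (fun z : ℂ => b * (z - a)) (b • ContinuousLinearMap.id ℝ ℂ) z :=
    ((hasFDerivAt_id z).sub_const a).const_mul b
  have h2 := (hd.hasFDerivAt.comp z h1).const_mul k
  have h3 : fderiv ℝ (fun z => k * G (b * (z - a))) z = (k • ContinuousLinearMap.id ℝ ℂ) ∘L
      (fderiv ℝ G (b * (z - a)) ∘L (b • ContinuousLinearMap.id ℝ ℂ)) := by
    refine h2.fderiv.trans ?_
    ext
    simp
  rw [h3]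
  exact (isInvertible_smul_id hk).comp (hG.comp (isInvertible_smul_id hb))

theorem HasRegularZeros.of_two_regions {f G : ℂ → ℂ} {k a b : ℂ} (hk : k ≠ 0) (hb : b ≠ 0)
    (hf : ∀ z, f z = k * G (b * (z - a))) (hG : Differentiable ℝ G) {K₁ K₂ : Set ℂ} {c₁ c₂ : ℕ}
    (hcover : ∀ z, f z = 0 → z ∈ K₁ ∨ b * (z - a) ∈ K₂)
    (hdisj : ∀ z ∈ K₁, b * (z - a) ∉ K₂)
    (h₁ : {z ∈ K₁ | f z = 0}.Finite ∧ {z ∈ K₁ | f z = 0}.ncard = c₁ ∧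
      ∀ z ∈ K₁, f z = 0 → (fderiv ℝ f z).IsInvertible)
    (h₂ : {z ∈ K₂ | G z = 0}.Finite ∧ {z ∈ K₂ | G z = 0}.ncard = c₂ ∧
      ∀ z ∈ K₂, G z = 0 → (fderiv ℝ G z).IsInvertible) :
    HasRegularZeros f (c₁ + c₂) := by
  have hinj : Function.Injective fun u : ℂ => a + b⁻¹ * u := fun u v h => by
    simpa [hb] using h
  have hfG : ∀ z, f z = 0 ↔ G (b * (z - a)) = 0 := fun z => by simp [hf, hk]
  have hset : {z | f z = 0} = {z ∈ K₁ | f z = 0} ∪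
      (fun u : ℂ => a + b⁻¹ * u) '' {z ∈ K₂ | G z = 0} := by
    ext z
    constructor
    · intro h
      rcases hcover z h with h' | h'
      · exact Or.inl ⟨h', h⟩
      · exact Or.inr ⟨b * (z - a), ⟨h', (hfG z).mp h⟩, by field_simp; ring⟩
    · rintro (h | ⟨u, h, rfl⟩)
      · exact h.2
      · refine (hfG _).mpr ?_
        simpa [hb] using h.2
  refine ⟨hset ▸ h₁.1.union (h₂.1.image _), ?_, fun z hz => ?_⟩
  · rw [hset, Set.ncard_union_eq ?_ h₁.1 (h₂.1.image _), Set.ncard_image_of_injective _ hinj,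
      h₁.2.1, h₂.2.1]
    rw [Set.disjoint_left]
    rintro z hz ⟨u, hu, rfl⟩
    refine hdisj _ hz.1 ?_
    simpa [hb] using hu.1
  · rcases hcover z hz with h | h
    · exact h₁.2.2 z h hz
    · rw [funext hf]
      exact isInvertible_fderiv_rescale hk hb (h₂.2.2 _ h ((hfG z).mp hz)) (hG _)

theorem ContDiff.polynomial_eval {E : Type*} [NormedAddCommGroup E] [NormedSpace ℝ E]
    {g : E → ℂ} (hg : ContDiff ℝ 1 g) (p : Polynomial ℂ) : ContDiff ℝ 1 fun v => p.eval (g v) := by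
  have h : ContDiff ℂ 1 fun z : ℂ => p.eval z := by
    simpa using Polynomial.contDiff_aeval (𝕜 := ℂ) p 1
  exact (h.restrict_scalars ℝ).comp hg

theorem contDiff_conj : ContDiff ℝ 1 (starRingEnd ℂ) :=
  (Complex.conjCLE : ℂ →L[ℝ] ℂ).contDiff

theorem contDiff_lensMap (p q r : Polynomial ℂ) : ContDiff ℝ 1 (lensMap p q r) :=
  ((contDiff_conj.polynomial_eval r).mul (contDiff_id.polynomial_eval q)).sub
    (contDiff_id.polynomial_eval p)

theorem hasFDerivAt_polynomial_eval (p : Polynomial ℂ) (z : ℂ) :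
    HasFDerivAt (fun z => p.eval z) (p.derivative.eval z • ContinuousLinearMap.id ℝ ℂ) z := by
  refine ((p.hasDerivAt z).hasFDerivAt.restrictScalars ℝ).congr_fderiv ?_
  ext
  simp [mul_comm]

theorem hasFDerivAt_conj (z : ℂ) :
    HasFDerivAt (starRingEnd ℂ) (Complex.conjCLE : ℂ →L[ℝ] ℂ) z :=
  (Complex.conjCLE : ℂ →L[ℝ] ℂ).hasFDerivAt

theorem isInvertible_fderiv_lensMap_X {p q : Polynomial ℂ} {z : ℂ}
    (h : ‖starRingEnd ℂ z * q.derivative.eval z - p.derivative.eval z‖ ≠ ‖q.eval z‖) :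
    (fderiv ℝ (lensMap p q Polynomial.X) z).IsInvertible := by
  have hd := ((hasFDerivAt_conj z).mul (hasFDerivAt_polynomial_eval q z)).sub
    (hasFDerivAt_polynomial_eval p z)
  have hl : lensMap p q Polynomial.X = fun z => starRingEnd ℂ z * q.eval z - p.eval z := by
    ext z
    simp [lensMap]
  rw [hl]
  refine HasFDerivAt.isInvertible_fderiv (hd.congr_fderiv ?_) h
  ext
  simp
  ring

/-- The homogenization of `p` in degree `n`, evaluated at `(ε, u)`. -/
noncomputable def homEval (p : Polynomial ℂ) (n : ℕ) (ε u : ℂ) : ℂ :=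
  ∑ k ∈ Finset.range (n + 1), p.coeff k * ε ^ (n - k) * u ^ k

theorem homEval_mul {p : Polynomial ℂ} {n : ℕ} (hp : p.natDegree ≤ n) (ε z : ℂ) :
    homEval p n ε (ε * z) = ε ^ n * p.eval z := by
  rw [Polynomial.eval_eq_sum_range' (Nat.lt_succ_of_le hp), Finset.mul_sum]
  refine Finset.sum_congr rfl fun k hk => ?_
  have hkn : k ≤ n := Nat.lt_succ_iff.mp (Finset.mem_range.mp hk)
  rw [mul_pow, ← pow_sub_mul_pow ε hkn]
  ring

theorem homEval_zero (p : Polynomial ℂ) (n : ℕ) (u : ℂ) :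
    homEval p n 0 u = p.coeff n * u ^ n := by
  rw [homEval, Finset.sum_range_succ, Finset.sum_eq_zero]
  · simp
  · intro k hk
    have : n - k ≠ 0 := Nat.sub_ne_zero_of_lt (Finset.mem_range.mp hk)
    simp [this]

theorem ContDiff.homEval {E : Type*} [NormedAddCommGroup E] [NormedSpace ℝ E] {e g : E → ℂ}
    (he : ContDiff ℝ 1 e) (hg : ContDiff ℝ 1 g) (p : Polynomial ℂ) (n : ℕ) :
    ContDiff ℝ 1 fun v => homEval p n (e v) (g v) :=
  ContDiff.sum fun _ _ => (contDiff_const.mul (he.pow _)).mul (hg.pow _)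

theorem exists_norm_eval_le {p q : Polynomial ℂ} {n : ℕ} (hp : p.natDegree ≤ n)
    (hq : q.natDegree = n) (hq0 : q ≠ 0) :
    ∃ C : ℝ, 0 ≤ C ∧ ∀ᶠ z in Bornology.cobounded ℂ, ‖p.eval z‖ ≤ C * ‖q.eval z‖ ∧ q.eval z ≠ 0 := by
  have hlim : ∀ g : Polynomial ℂ, Tendsto (fun z : ℂ => homEval g n z⁻¹ 1)
      (Bornology.cobounded ℂ) (𝓝 (g.coeff n)) := fun g => by
    have hc : Continuous fun e : ℂ => homEval g n e 1 :=
      (ContDiff.homEval contDiff_id contDiff_const g n).continuous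
    have := (hc.tendsto 0).comp tendsto_inv₀_cobounded
    simpa [homEval_zero, Function.comp_def] using this
  have heval : ∀ g : Polynomial ℂ, g.natDegree ≤ n → ∀ z : ℂ, z ≠ 0 →
      g.eval z = z ^ n * homEval g n z⁻¹ 1 := fun g hg z hz => by
    have := homEval_mul hg z⁻¹ z
    rw [inv_mul_cancel₀ hz] at this
    rw [this, ← mul_assoc, ← mul_pow, mul_inv_cancel₀ hz, one_pow, one_mul]
  have hlead : 0 < ‖q.coeff n‖ := by
    rw [← hq]
    simpa using hq0
  refine ⟨(‖p.coeff n‖ + 1) / (‖q.coeff n‖ / 2), by positivity, ?_⟩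
  filter_upwards [(hlim p).norm.eventually_lt_const (lt_add_one _),
    (hlim q).norm.eventually_const_lt (half_lt_self hlead), Bornology.eventually_ne_cobounded 0]
    with z h1 h2 hz
  have h0 : homEval q n z⁻¹ 1 ≠ 0 := norm_pos_iff.mp ((half_pos hlead).trans h2)
  rw [heval p hp z hz, heval q hq.le z hz]
  refine ⟨?_, mul_ne_zero (pow_ne_zero _ hz) h0⟩
  rw [norm_mul, norm_mul, mul_left_comm]
  refine mul_le_mul_of_nonneg_left ?_ (norm_nonneg _)
  calc ‖homEval p n z⁻¹ 1‖ ≤ (‖p.coeff n‖ + 1) / (‖q.coeff n‖ / 2) * (‖q.coeff n‖ / 2) := by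
        rw [div_mul_cancel₀ _ (half_pos hlead).ne']
        exact h1.le
    _ ≤ _ := by gcongr

theorem exists_forall_of_eventually_cobounded {P : ℂ → Prop}
    (h : ∀ᶠ z in Bornology.cobounded ℂ, P z) : ∃ M : ℝ, ∀ z, M ≤ ‖z‖ → P z := by
  obtain ⟨M, -, hM⟩ := hasBasis_cobounded_norm.eventually_iff.mp h
  exact ⟨M, fun z hz => hM hz⟩

theorem lensMap_mul_one_add (p q r : Polynomial ℂ) (ε : ℂ) (z : ℂ) :
    lensMap p q (r * (1 + Polynomial.C ε * Polynomial.X)) z =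
      r.eval (starRingEnd ℂ z) * (1 + ε * starRingEnd ℂ z) * q.eval z - p.eval z := by
  simp [lensMap]

theorem HasRegularZeros.exists_natDegree_succ {p q r : Polynomial ℂ} {c : ℕ} (hr : 1 ≤ r.natDegree)
    (hq : q ≠ 0) (hpq : p.natDegree ≤ q.natDegree) (h : HasRegularZeros (lensMap p q r) c) :
    ∃ r' : Polynomial ℂ, r'.natDegree = r.natDegree + 1 ∧
      HasRegularZeros (lensMap p q r') (c + 1) := by
  set m := r.natDegree with hm
  set n := q.natDegree with hn
  have hr0 : r ≠ 0 := by
    rintro rfl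
    simp at hm
    omega
  obtain ⟨C, hC0, hC⟩ := exists_norm_eval_le hpq hn.symm hq
  have hrinf : ∀ᶠ z in Bornology.cobounded ℂ, 2 * C < ‖r.eval (starRingEnd ℂ z)‖ :=
    (Polynomial.tendsto_norm_atTop r (Polynomial.natDegree_pos_iff_degree_pos.mp hr)
      (z := fun z : ℂ => starRingEnd ℂ z) (l := Bornology.cobounded ℂ) (by
        simpa using tendsto_norm_cobounded_atTop (E := ℂ))).eventually_gt_atTop _
  obtain ⟨M, hM⟩ := exists_forall_of_eventually_cobounded (hC.and hrinf)
  have hbig : ∀ z, M ≤ ‖z‖ → 2 * ‖p.eval z‖ < ‖r.eval (starRingEnd ℂ z) * q.eval z‖ := by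
    intro z hz
    obtain ⟨⟨h1, h2⟩, h3⟩ := hM z hz
    rw [norm_mul]
    have := mul_lt_mul_of_pos_right h3 (norm_pos_iff.mpr h2)
    linarith
  let F : ℝ × ℂ → ℂ := fun v => r.eval (starRingEnd ℂ v.2) * (1 + v.1 * starRingEnd ℂ v.2) *
    q.eval v.2 - p.eval v.2
  let G : ℝ × ℂ → ℂ := fun v => homEval r m v.1 (starRingEnd ℂ v.2) * (1 + starRingEnd ℂ v.2) *
    homEval q n v.1 v.2 - v.1 ^ m * homEval p n v.1 v.2
  have hfst : ContDiff ℝ 1 fun v : ℝ × ℂ => (v.1 : ℂ) :=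
    Complex.ofRealCLM.contDiff.comp contDiff_fst
  have hconj : ContDiff ℝ 1 fun v : ℝ × ℂ => starRingEnd ℂ v.2 := contDiff_conj.comp contDiff_snd
  have hFd : ContDiff ℝ 1 F :=
    (((hconj.polynomial_eval r).mul (contDiff_const.add (hfst.mul hconj))).mul
      (contDiff_snd.polynomial_eval q)).sub (contDiff_snd.polynomial_eval p)
  have hGd : ContDiff ℝ 1 G :=
    (((hfst.homEval hconj r m).mul (contDiff_const.add hconj)).mul
      (hfst.homEval contDiff_snd q n)).sub ((hfst.pow m).mul (hfst.homEval contDiff_snd p n))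
  have hF0 : (fun z => F (0, z)) = lensMap p q r := by
    ext z
    simp [F, lensMap]
  have hG0 : (fun z => G (0, z)) = fun z => (r.coeff m * starRingEnd ℂ z ^ m) *
      (q.coeff n * z ^ n) * (1 + starRingEnd ℂ z) := by
    ext z
    have : m ≠ 0 := by omega
    simp [G, homEval_zero, this]
    ring
  have hlr : r.coeff m ≠ 0 := by simpa [hm] using hr0
  have hlq : q.coeff n ≠ 0 := by simpa [hn] using hq
  have e1 := eventually_ncard_zeros_eq hFd (isCompact_closedBall 0 M) h.1
    (fun z _ => by rw [congrFun hF0 z]; rfl)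
    (fun z hz => by
      refine Metric.ball_subset_interior_closedBall ?_
      rw [mem_ball_zero_iff]
      by_contra hlt
      have h1 := hbig z (not_lt.mp hlt)
      rw [sub_eq_zero.mp hz] at h1
      linarith [norm_nonneg (p.eval z)])
    (fun z hz => by rw [hF0]; exact h.2.2 z hz)
  have hK2 : ∀ z ∈ Metric.closedBall (-1 : ℂ) (1 / 2), 1 / 2 ≤ ‖z‖ := fun z hz => by
    rw [mem_closedBall_iff_norm] at hz
    have := norm_sub_norm_le (-1 : ℂ) z
    rw [norm_sub_rev] at this
    simp only [norm_neg, norm_one] at this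
    linarith
  have e2 := eventually_ncard_zeros_eq hGd (isCompact_closedBall (-1) (1 / 2))
    (S := {-1}) (Set.finite_singleton _)
    (fun z hz => by
      have hz0 : z ≠ 0 := norm_pos_iff.mp (by linarith [hK2 z hz])
      rw [congrFun hG0 z, Set.mem_singleton_iff]
      simp only [mul_eq_zero, pow_eq_zero_iff', hlr, hlq, hz0, map_eq_zero, false_and, or_false,
        false_or]
      rw [← map_one (starRingEnd ℂ), ← map_add, map_eq_zero, map_one, add_comm,
        add_eq_zero_iff_eq_neg])
    (by
      rw [Set.singleton_subset_iff]
      exact Metric.ball_subset_interior_closedBall (Metric.mem_ball_self (by norm_num)))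
    (fun z hz => by
      rw [Set.mem_singleton_iff] at hz
      subst hz
      rw [hG0]
      have hu : DifferentiableAt ℝ (fun z : ℂ => (r.coeff m * starRingEnd ℂ z ^ m) *
          (q.coeff n * z ^ n)) (-1) :=
        (((contDiff_const.mul (contDiff_conj.pow m)).mul
          (contDiff_const.mul (contDiff_id.pow n))).differentiable one_ne_zero) _
      have hd := hu.hasFDerivAt.mul ((hasFDerivAt_conj (-1)).const_add 1)
      have hne : (r.coeff m * starRingEnd ℂ (-1) ^ m) * (q.coeff n * (-1) ^ n) ≠ 0 := by
        simp [hlr, hlq]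
      refine HasFDerivAt.isInvertible_fderiv (α := 0)
        (β := (r.coeff m * starRingEnd ℂ (-1) ^ m) * (q.coeff n * (-1) ^ n))
        (hd.congr_fderiv ?_) ?_
      · ext
        simp
      · rw [norm_zero]
        exact (norm_pos_iff.mpr hne).ne)
  have e3 : ∀ᶠ ε in 𝓝 (0 : ℝ), ε * M < 1 / 2 := by
    have : Tendsto (fun ε : ℝ => ε * M) (𝓝 0) (𝓝 (0 * M)) := (continuous_mul_const M).tendsto 0
    exact this.eventually_lt_const (by norm_num)
  obtain ⟨ε, ⟨⟨h1, h2⟩, h3⟩, hε⟩ :=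
    (((e1.and e2).and e3).filter_mono nhdsWithin_le_nhds |>.and
      (self_mem_nhdsWithin : ∀ᶠ ε in 𝓝[>] (0 : ℝ), ε ∈ Set.Ioi 0)).exists
  have hεC : (ε : ℂ) ≠ 0 := by exact_mod_cast hε.ne'
  refine ⟨r * (1 + Polynomial.C (ε : ℂ) * Polynomial.X), ?_, ?_⟩
  · have hd : (1 + Polynomial.C (ε : ℂ) * Polynomial.X).natDegree = 1 := by
      rw [add_comm]
      simpa using Polynomial.natDegree_linear (b := 1) hεC
    rw [Polynomial.natDegree_mul hr0 (Polynomial.ne_zero_of_natDegree_gt (n := 0) (by omega)), hd]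
  · have hf : lensMap p q (r * (1 + Polynomial.C (ε : ℂ) * Polynomial.X)) = fun z => F (ε, z) :=
      funext fun z => lensMap_mul_one_add p q r ε z
    rw [hf]
    rw [Set.ncard_singleton] at h2
    refine HasRegularZeros.of_two_regions (G := fun u => G (ε, u)) (a := 0)
      (k := ((ε : ℂ) ^ (m + n))⁻¹) (b := (ε : ℂ)) (inv_ne_zero (pow_ne_zero _ hεC)) hεC ?_
      ((hGd.comp (contDiff_const.prodMk contDiff_id)).differentiable one_ne_zero) ?_ ?_
      ⟨h1.1, h1.2.1.trans h.2.1, h1.2.2⟩ h2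
    · intro z
      rw [eq_inv_mul_iff_mul_eq₀ (pow_ne_zero _ hεC)]
      have hc : starRingEnd ℂ ((ε : ℂ) * z) = ε * starRingEnd ℂ z := by simp
      simp only [F, G, sub_zero, hc, homEval_mul hm.ge, homEval_mul hn.ge, homEval_mul hpq]
      ring
    · intro z hz
      by_cases hzM : ‖z‖ ≤ M
      · exact Or.inl (mem_closedBall_zero_iff.mpr hzM)
      · right
        have hb := hbig z (not_le.mp hzM).le
        have hz' : r.eval (starRingEnd ℂ z) * q.eval z * (1 + ε * starRingEnd ℂ z) = p.eval z := by
          rw [← sub_eq_zero.mp hz]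
          ring
        rw [← hz', norm_mul] at hb
        have hpos : 0 < ‖r.eval (starRingEnd ℂ z) * q.eval z‖ :=
          lt_of_le_of_lt (by positivity) hb
        have hlt : ‖1 + (ε : ℂ) * starRingEnd ℂ z‖ < 1 / 2 := by
          by_contra hge
          nlinarith
        rw [mem_closedBall_iff_norm, sub_zero, sub_neg_eq_add, add_comm]
        rw [← RCLike.norm_conj]
        simpa using hlt.le
    · intro z hz hz2
      have h4 := hK2 _ hz2
      rw [sub_zero, norm_mul, Complex.norm_real, Real.norm_of_nonneg hε.le] at h4
      rw [mem_closedBall_zero_iff] at hz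
      have := mul_le_mul_of_nonneg_left hz hε.le
      linarith

theorem HasRegularZeros.exists_natDegree_eq {p q : Polynomial ℂ} {c : ℕ}
    (hq : q ≠ 0) (hpq : p.natDegree ≤ q.natDegree)
    (h : HasRegularZeros (lensMap p q Polynomial.X) c) {m : ℕ} (hm : 1 ≤ m) :
    ∃ r : Polynomial ℂ, r.natDegree = m ∧ HasRegularZeros (lensMap p q r) (c + (m - 1)) := by
  induction m, hm using Nat.le_induction with
  | base => exact ⟨Polynomial.X, Polynomial.natDegree_X, h⟩
  | succ m hm ih =>
    obtain ⟨r, hr, hz⟩ := ih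
    obtain ⟨r', hr', hz'⟩ := hz.exists_natDegree_succ (hr.symm ▸ hm) hq hpq
    exact ⟨r', by omega, by convert hz' using 1; omega⟩

theorem finite_setOf_pow_eq {N : ℕ} (hN : 0 < N) (w : ℂ) : {z : ℂ | z ^ N = w}.Finite := by
  refine (Polynomial.nthRootsFinset N w).finite_toSet.subset fun z hz => ?_
  simpa [Polynomial.mem_nthRootsFinset hN] using hz

theorem ncard_setOf_pow_eq {N : ℕ} (hN : 0 < N) {w : ℂ} (hw : w ≠ 0) :
    {z : ℂ | z ^ N = w}.ncard = N := by
  classical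
  obtain ⟨a, ha⟩ := IsAlgClosed.exists_pow_nat_eq w hN
  have ha0 : a ≠ 0 := by
    rintro rfl
    exact hw (by rw [← ha, zero_pow hN.ne'])
  have hset : {z : ℂ | z ^ N = w} = (fun ζ => a * ζ) '' (Polynomial.nthRootsFinset N (1 : ℂ)) := by
    ext z
    constructor
    · intro hz
      refine ⟨z / a, ?_, mul_div_cancel₀ _ ha0⟩
      rw [Finset.mem_coe, Polynomial.mem_nthRootsFinset hN, div_pow, ha, hz, div_self hw]
    · rintro ⟨ζ, hζ, rfl⟩
      rw [Finset.mem_coe, Polynomial.mem_nthRootsFinset hN] at hζ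
      simp [mul_pow, ha, hζ]
  rw [hset, Set.ncard_image_of_injective _ (mul_right_injective₀ ha0), Set.ncard_coe_finset,
    (Complex.isPrimitiveRoot_exp N hN.ne').card_nthRootsFinset]

theorem normSq_sub_one_eq_iff {b : ℂ} (h0 : b ≠ 0) (h1 : ‖b‖ < 1) (u : ℂ) :
    ((‖u‖ ^ 2 - 1 : ℝ) : ℂ) = b * u ^ 2 ↔
      u ^ 2 = (‖b‖ / (1 - ‖b‖) : ℝ) / b ∨ u ^ 2 = (-(‖b‖ / (1 + ‖b‖)) : ℝ) / b := by
  have hb : 0 < ‖b‖ := norm_pos_iff.mpr h0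
  have h2 : 0 < 1 - ‖b‖ := by linarith
  rw [eq_div_iff h0, eq_div_iff h0, mul_comm (u ^ 2) b]
  constructor
  · intro h
    have hn := congrArg norm h
    rw [Complex.norm_real, norm_mul, norm_pow, Real.norm_eq_abs] at hn
    rw [← h]
    rcases abs_choice (‖u‖ ^ 2 - 1) with ha | ha
    · left
      rw [Complex.ofReal_inj, eq_div_iff h2.ne']
      linarith
    · right
      rw [Complex.ofReal_inj, ← neg_div, eq_div_iff (by positivity)]
      linarith
  · have key : ∀ t : ℝ, b * u ^ 2 = t → |t| = ‖b‖ * (t + 1) →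
      ((‖u‖ ^ 2 - 1 : ℝ) : ℂ) = b * u ^ 2 := by
      intro t ht hbt
      rw [ht, Complex.ofReal_inj]
      have hn := congrArg norm ht
      rw [Complex.norm_real, norm_mul, norm_pow, Real.norm_eq_abs, hbt] at hn
      linarith [mul_left_cancel₀ hb.ne' hn]
    rintro (h | h)
    · refine key _ h ?_
      rw [abs_of_pos (by positivity)]
      field_simp
      ring
    · refine key _ h ?_
      rw [abs_neg, abs_of_pos (by positivity)]
      field_simp
      ring

theorem ncard_normSq_sub_one_eq {b : ℂ} (h0 : b ≠ 0) (h1 : ‖b‖ < 1) :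
    {u : ℂ | ((‖u‖ ^ 2 - 1 : ℝ) : ℂ) = b * u ^ 2}.Finite ∧
      {u : ℂ | ((‖u‖ ^ 2 - 1 : ℝ) : ℂ) = b * u ^ 2}.ncard = 4 := by
  have hb : 0 < ‖b‖ := norm_pos_iff.mpr h0
  have h2 : 0 < 1 - ‖b‖ := by linarith
  have hset : {u : ℂ | ((‖u‖ ^ 2 - 1 : ℝ) : ℂ) = b * u ^ 2} =
      {u : ℂ | u ^ 2 = (‖b‖ / (1 - ‖b‖) : ℝ) / b} ∪
      {u : ℂ | u ^ 2 = (-(‖b‖ / (1 + ‖b‖)) : ℝ) / b} :=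
    Set.ext (normSq_sub_one_eq_iff h0 h1)
  have hp : 0 < ‖b‖ / (1 - ‖b‖) := by positivity
  have hm : 0 < ‖b‖ / (1 + ‖b‖) := by positivity
  rw [hset]
  refine ⟨(finite_setOf_pow_eq two_pos _).union (finite_setOf_pow_eq two_pos _), ?_⟩
  have hp' : ((‖b‖ / (1 - ‖b‖) : ℝ) : ℂ) / b ≠ 0 := div_ne_zero (by exact_mod_cast hp.ne') h0
  have hm' : ((-(‖b‖ / (1 + ‖b‖)) : ℝ) : ℂ) / b ≠ 0 :=
    div_ne_zero (by exact_mod_cast (neg_neg_of_pos hm).ne) h0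
  have hd : Disjoint {u : ℂ | u ^ 2 = (‖b‖ / (1 - ‖b‖) : ℝ) / b}
      {u : ℂ | u ^ 2 = (-(‖b‖ / (1 + ‖b‖)) : ℝ) / b} := by
    rw [Set.disjoint_left]
    intro u hu hu'
    have := hu.symm.trans hu'
    rw [div_left_inj' h0, Complex.ofReal_inj] at this
    linarith
  rw [Set.ncard_union_eq hd (finite_setOf_pow_eq two_pos _) (finite_setOf_pow_eq two_pos _),
    ncard_setOf_pow_eq two_pos hp', ncard_setOf_pow_eq two_pos hm']
  rfl

theorem normSq_le_of_normSq_sub_one_eq {b u : ℂ}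
    (hu : ((‖u‖ ^ 2 - 1 : ℝ) : ℂ) = b * u ^ 2) : ‖u‖ ^ 2 * (1 - ‖b‖) ≤ 1 := by
  have hn := congrArg norm hu
  rw [Complex.norm_real, norm_mul, norm_pow, Real.norm_eq_abs] at hn
  linarith [le_abs_self (‖u‖ ^ 2 - 1)]

theorem HasRegularZeros.exists_add_pole {p q : Polynomial ℂ} {c : ℕ} (hq : q ≠ 0)
    (hpq : p.natDegree ≤ q.natDegree) (h : HasRegularZeros (lensMap p q Polynomial.X) c) {a : ℂ}
    (ha : lensMap p q Polynomial.X a = 0)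
    (ha0 : starRingEnd ℂ a * q.derivative.eval a - p.derivative.eval a ≠ 0)
    (ha1 : ‖starRingEnd ℂ a * q.derivative.eval a - p.derivative.eval a‖ < ‖q.eval a‖) :
    ∃ p' q' : Polynomial ℂ, q'.natDegree = q.natDegree + 1 ∧ p'.natDegree ≤ q'.natDegree ∧
      HasRegularZeros (lensMap p' q' Polynomial.X) (c + 3) := by
  obtain ⟨g, hg⟩ : Polynomial.X - Polynomial.C a ∣ Polynomial.C (starRingEnd ℂ a) * q - p := by
    rw [Polynomial.dvd_iff_isRoot]
    simpa [lensMap] using ha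
  have hga : g.eval a = starRingEnd ℂ a * q.derivative.eval a - p.derivative.eval a := by
    have := congrArg (fun P : Polynomial ℂ => P.derivative.eval a) hg
    simpa using this.symm
  rw [← hga] at ha0 ha1
  have hf : ∀ z, lensMap p q Polynomial.X z =
      starRingEnd ℂ (z - a) * q.eval z + (z - a) * g.eval z := fun z => by
    have := congrArg (fun P : Polynomial ℂ => P.eval z) hg
    simp only [Polynomial.eval_sub, Polynomial.eval_mul, Polynomial.eval_C,
      Polynomial.eval_X] at this
    rw [← this, lensMap, Polynomial.eval_X, map_sub]
    ring
  have hqa : 0 < ‖q.eval a‖ := (norm_nonneg _).trans_lt ha1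
  have hqa' : q.eval a ≠ 0 := norm_pos_iff.mp hqa
  set b : ℂ := -(g.eval a / q.eval a) with hb
  have hb0 : b ≠ 0 := neg_ne_zero.mpr (div_ne_zero ha0 hqa')
  have hbn : ‖b‖ = ‖g.eval a‖ / ‖q.eval a‖ := by rw [hb, norm_neg, norm_div]
  have hb1 : ‖b‖ < 1 := by rw [hbn, div_lt_one hqa]; exact ha1
  have hbpos : 0 < ‖b‖ := norm_pos_iff.mpr hb0
  obtain ⟨δ, hδ⟩ : ∃ δ : ℝ, δ = (1 - ‖b‖) / 2 := ⟨_, rfl⟩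
  have hδ0 : 0 < δ := by linarith
  have hδ1 : δ < 1 := by linarith
  obtain ⟨κ, hκ, hnear⟩ : ∃ κ > 0, ∀ z ∈ Metric.closedBall a κ,
      ‖g.eval z‖ < (1 - δ) * ‖q.eval z‖ := by
    have hlt : ‖g.eval a‖ < (1 - δ) * ‖q.eval a‖ := by
      rw [← div_lt_iff₀ hqa, ← hbn]
      linarith
    have := (g.continuous.norm.tendsto a).eventually_lt
      ((q.continuous.norm.const_mul (1 - δ)).tendsto a) hlt
    exact Metric.nhds_basis_closedBall.eventually_iff.mp this
  have hqnear : ∀ z ∈ Metric.closedBall a κ, 0 < ‖q.eval z‖ := fun z hz =>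
    pos_of_mul_pos_right ((norm_nonneg _).trans_lt (hnear z hz)) (by linarith)
  have hfnear : ∀ z ∈ Metric.closedBall a κ,
      δ * (‖z - a‖ * ‖q.eval z‖) ≤ ‖lensMap p q Polynomial.X z‖ := fun z hz => by
    have h1 := norm_sub_le_norm_add (starRingEnd ℂ (z - a) * q.eval z) ((z - a) * g.eval z)
    rw [norm_mul, norm_mul, RCLike.norm_conj] at h1
    rw [hf]
    have h2 := mul_le_mul_of_nonneg_left (hnear z hz).le (norm_nonneg (z - a))
    linarith
  obtain ⟨C, hC0, hC⟩ := exists_norm_eval_le hpq rfl hq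
  obtain ⟨M₀, hM₀⟩ := exists_forall_of_eventually_cobounded hC
  obtain ⟨M, hM0, hMC, hMa⟩ : ∃ M, M₀ ≤ M ∧ C + 1 < M ∧ ‖a‖ + 1 ≤ M :=
    ⟨max M₀ (max (C + 2) (‖a‖ + 1)), le_max_left _ _,
      by linarith [le_max_right M₀ (max (C + 2) (‖a‖ + 1)), le_max_left (C + 2) (‖a‖ + 1)],
      by linarith [le_max_right M₀ (max (C + 2) (‖a‖ + 1)), le_max_right (C + 2) (‖a‖ + 1)]⟩
  have hbig : ∀ z, M ≤ ‖z‖ → ∀ ε : ℝ, |ε| ≤ 1 →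
      lensMap p q Polynomial.X z * (z - a) - ε ^ 2 * q.eval z ≠ 0 := by
    intro z hz ε hε h0
    obtain ⟨h1, h2⟩ := hM₀ z (hM0.trans hz)
    have h2' := norm_pos_iff.mpr h2
    have h3 : 1 ≤ ‖z - a‖ := by linarith [norm_sub_norm_le z a]
    have h4 := congrArg norm (sub_eq_zero.mp h0)
    rw [norm_mul, norm_mul, norm_pow, Complex.norm_real, Real.norm_eq_abs] at h4
    have h5 : (‖z‖ - C) * ‖q.eval z‖ ≤ ‖lensMap p q Polynomial.X z‖ := by
      have := norm_sub_norm_le (starRingEnd ℂ z * q.eval z) (p.eval z)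
      rw [norm_mul, RCLike.norm_conj] at this
      simp only [lensMap, Polynomial.eval_X]
      linarith
    have h6 : ‖q.eval z‖ < ‖lensMap p q Polynomial.X z‖ := by nlinarith
    have h7 : |ε| ^ 2 ≤ 1 := pow_le_one₀ (abs_nonneg _) hε
    nlinarith
  let F : ℝ × ℂ → ℂ := fun v => lensMap p q Polynomial.X v.2 * (v.2 - a) - v.1 ^ 2 * q.eval v.2
  let G : ℝ × ℂ → ℂ := fun v => (starRingEnd ℂ v.2 * v.2 - 1) * q.eval (a + v.1 * v.2) +
    v.2 ^ 2 * g.eval (a + v.1 * v.2)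
  have hfst : ContDiff ℝ 1 fun v : ℝ × ℂ => (v.1 : ℂ) :=
    Complex.ofRealCLM.contDiff.comp contDiff_fst
  have hconj : ContDiff ℝ 1 fun v : ℝ × ℂ => starRingEnd ℂ v.2 := contDiff_conj.comp contDiff_snd
  have hFd : ContDiff ℝ 1 F :=
    (((contDiff_lensMap p q Polynomial.X).comp contDiff_snd).mul
      (contDiff_snd.sub contDiff_const)).sub ((hfst.pow 2).mul (contDiff_snd.polynomial_eval q))
  have haff : ContDiff ℝ 1 fun v : ℝ × ℂ => a + v.1 * v.2 :=
    contDiff_const.add (hfst.mul contDiff_snd)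
  have hGd : ContDiff ℝ 1 G :=
    (((hconj.mul contDiff_snd).sub contDiff_const).mul (haff.polynomial_eval q)).add
      ((contDiff_snd.pow 2).mul (haff.polynomial_eval g))
  have hF0 : (fun z => F (0, z)) = fun z => lensMap p q Polynomial.X z * (z - a) := by
    ext z
    simp [F]
  have hG0 : (fun z => G (0, z)) = fun z => (starRingEnd ℂ z * z - 1) * q.eval a +
    z ^ 2 * g.eval a := by
    ext z
    simp [G]
  have hG0iff : ∀ u, G (0, u) = 0 ↔ ((‖u‖ ^ 2 - 1 : ℝ) : ℂ) = b * u ^ 2 := fun u => by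
    rw [congrFun hG0 u, Complex.conj_mul', hb, add_eq_zero_iff_eq_neg, ← eq_div_iff hqa']
    push_cast
    constructor <;> intro h <;> rw [h] <;> field_simp
  have e1 := eventually_ncard_zeros_eq hFd (S := {z | lensMap p q Polynomial.X z = 0} \ {a})
    ((isCompact_closedBall 0 M).diff Metric.isOpen_ball : IsCompact (_ \ Metric.ball a κ)) h.1.sdiff
    (fun z hz => by
      have hza : z ≠ a := by
        rintro rfl
        exact hz.2 (Metric.mem_ball_self hκ)
      rw [congrFun hF0 z]
      simp [sub_eq_zero, hza])
    (fun z hz => by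
      have hopen : IsOpen (Metric.ball (0 : ℂ) M \ Metric.closedBall a κ) :=
        Metric.isOpen_ball.sdiff Metric.isClosed_closedBall
      refine interior_maximal (Set.sdiff_subset_sdiff Metric.ball_subset_closedBall
        Metric.ball_subset_closedBall) hopen ⟨?_, fun hzκ => ?_⟩
      · rw [mem_ball_zero_iff]
        by_contra hlt
        refine hbig z (not_lt.mp hlt) 0 (by simp) ?_
        rw [show lensMap p q Polynomial.X z = 0 from hz.1]
        simp
      · have h1 := hfnear z hzκ
        rw [show lensMap p q Polynomial.X z = 0 from hz.1, norm_zero] at h1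
        have h2 : 0 < ‖z - a‖ := norm_pos_iff.mpr (sub_ne_zero.mpr hz.2)
        have h3 := hqnear z hzκ
        have : 0 < δ * (‖z - a‖ * ‖q.eval z‖) := by positivity
        linarith)
    (fun z hz => by
      have hza : z - a ≠ 0 := sub_ne_zero.mpr hz.2
      have hz0 : lensMap p q Polynomial.X z = 0 := hz.1
      rw [hF0]
      have hd :=
        (((contDiff_lensMap p q Polynomial.X).differentiable one_ne_zero z).hasFDerivAt).mul
        ((hasFDerivAt_id (𝕜 := ℝ) z).sub_const a)
      have he : fderiv ℝ (fun z => lensMap p q Polynomial.X z * (z - a)) z =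
          ((z - a) • ContinuousLinearMap.id ℝ ℂ) ∘L fderiv ℝ (lensMap p q Polynomial.X) z := by
        refine hd.fderiv.trans ?_
        ext
        simp [hz0]
      rw [he]
      exact (isInvertible_smul_id hza).comp (h.2.2 z hz0))
  have e2 := eventually_ncard_zeros_eq hGd (isCompact_closedBall 0 (1 / δ))
    (ncard_normSq_sub_one_eq hb0 hb1).1 (fun u _ => hG0iff u)
    (fun u hu => by
      refine Metric.ball_subset_interior_closedBall ?_
      have h1 := normSq_le_of_normSq_sub_one_eq hu
      rw [show 1 - ‖b‖ = 2 * δ by linarith] at h1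
      rw [mem_ball_zero_iff, lt_div_iff₀ hδ0]
      have h2 : (‖u‖ * δ) ^ 2 < 1 := by nlinarith [norm_nonneg u]
      exact (sq_lt_one_iff₀ (by positivity)).mp h2)
    (fun u hu => by
      rw [hG0]
      have hd := (((hasFDerivAt_conj u).mul (hasFDerivAt_id (𝕜 := ℝ) u)).sub_const 1
        |>.mul_const (q.eval a)).add (((hasFDerivAt_id (𝕜 := ℝ) u).pow 2).mul_const (g.eval a))
      refine HasFDerivAt.isInvertible_fderiv
        (α := q.eval a * (starRingEnd ℂ u - 2 * b * u))
        (β := q.eval a * u) (hd.congr_fderiv ?_) ?_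
      · ext
        simp [hb]
        field_simp
        ring
      · rw [norm_mul, norm_mul]
        intro he
        have he' := mul_left_cancel₀ hqa.ne' he
        have h1 : u * (starRingEnd ℂ u - 2 * b * u) = ((2 - ‖u‖ ^ 2 : ℝ) : ℂ) := by
          have h2 := Complex.mul_conj' u
          have h3 : ((‖u‖ ^ 2 - 1 : ℝ) : ℂ) = b * u ^ 2 := hu
          push_cast at h3 ⊢
          linear_combination h2 + 2 * h3
        have h4 := congrArg norm h1
        rw [norm_mul, he', Complex.norm_real, Real.norm_eq_abs] at h4
        have h5 : ‖u‖ ^ 2 = 1 := by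
          rcases abs_choice (2 - ‖u‖ ^ 2) with ha | ha <;> nlinarith
        have h6 : ((‖u‖ ^ 2 - 1 : ℝ) : ℂ) = b * u ^ 2 := hu
        rw [h5, sub_self, Complex.ofReal_zero, eq_comm, mul_eq_zero] at h6
        have h7 : u = 0 := by simpa [hb0] using h6
        simp [h7] at h5)
  have e3 : ∀ᶠ ε in 𝓝 (0 : ℝ), ε * (1 / δ) < κ := by
    have : Tendsto (fun ε : ℝ => ε * (1 / δ)) (𝓝 0) (𝓝 (0 * (1 / δ))) :=
      (continuous_mul_const _).tendsto 0
    exact this.eventually_lt_const (by simpa using hκ)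
  obtain ⟨ε, ⟨⟨⟨h1, h2⟩, h3⟩, hε1⟩, hε⟩ :=
    ((((e1.and e2).and e3).and (eventually_lt_nhds one_pos)).filter_mono nhdsWithin_le_nhds |>.and
      (self_mem_nhdsWithin : ∀ᶠ ε in 𝓝[>] (0 : ℝ), ε ∈ Set.Ioi 0)).exists
  have hε0 : 0 < ε := hε
  have hεC : (ε : ℂ) ≠ 0 := by exact_mod_cast hε0.ne'
  have hX : (Polynomial.X - Polynomial.C a) ≠ 0 := Polynomial.X_sub_C_ne_zero a
  have hdeg : (q * (Polynomial.X - Polynomial.C a)).natDegree = q.natDegree + 1 := by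
    rw [Polynomial.natDegree_mul hq hX, Polynomial.natDegree_X_sub_C]
  refine ⟨p * (Polynomial.X - Polynomial.C a) + Polynomial.C ((ε : ℂ) ^ 2) * q,
    q * (Polynomial.X - Polynomial.C a), hdeg, ?_, ?_⟩
  · rw [hdeg]
    refine Polynomial.natDegree_add_le_of_degree_le (Polynomial.natDegree_mul_le.trans ?_)
      ((Polynomial.natDegree_C_mul_le _ _).trans (Nat.le_succ _))
    rw [Polynomial.natDegree_X_sub_C]
    omega
  · have hf' : lensMap (p * (Polynomial.X - Polynomial.C a) + Polynomial.C ((ε : ℂ) ^ 2) * q)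
        (q * (Polynomial.X - Polynomial.C a)) Polynomial.X = fun z => F (ε, z) := by
      ext z
      simp [lensMap, F]
      ring
    have hc : 0 < c := by
      rw [← h.2.1]
      exact (Set.ncard_pos h.1).mpr ⟨a, ha⟩
    rw [hf', show c + 3 = (c - 1) + 4 by omega]
    refine HasRegularZeros.of_two_regions (G := fun u => G (ε, u)) (a := a)
      (k := (ε : ℂ) ^ 2) (b := (ε : ℂ)⁻¹) (pow_ne_zero _ hεC) (inv_ne_zero hεC) ?_
      ((hGd.comp (contDiff_const.prodMk contDiff_id)).differentiable one_ne_zero) ?_ ?_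
      ⟨h1.1, h1.2.1.trans ?_, h1.2.2⟩
      ⟨h2.1, h2.2.1.trans (ncard_normSq_sub_one_eq hb0 hb1).2, h2.2.2⟩
    · intro z
      have h4 : a + (ε : ℂ) * ((ε : ℂ)⁻¹ * (z - a)) = z := by
        rw [mul_inv_cancel_left₀ hεC]
        ring
      simp only [F, G, h4, hf, map_mul, map_inv₀, Complex.conj_ofReal]
      field_simp
      ring
    · intro z hz
      by_cases hzM : ‖z‖ ≤ M
      · by_cases hzκ : z ∈ Metric.closedBall a κ
        · right
          rw [mem_closedBall_zero_iff, norm_mul, norm_inv, Complex.norm_real,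
            Real.norm_of_nonneg hε0.le]
          have h4 := congrArg norm (sub_eq_zero.mp hz)
          rw [norm_mul, norm_mul, norm_pow, Complex.norm_real, Real.norm_eq_abs, sq_abs] at h4
          have h5 := mul_le_mul_of_nonneg_right (hfnear z hzκ) (norm_nonneg (z - a))
          have h6 := hqnear z hzκ
          have h7 : δ * ‖z - a‖ ^ 2 ≤ ε ^ 2 := by
            refine le_of_mul_le_mul_right ?_ h6
            linarith
          rw [inv_mul_le_iff₀ hε0, mul_one_div, le_div_iff₀ hδ0]
          refine (pow_le_pow_iff_left₀ (by positivity) hε0.le two_ne_zero).mp ?_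
          nlinarith [mul_nonneg (mul_nonneg hδ0.le (sub_nonneg.mpr hδ1.le)) (sq_nonneg ‖z - a‖)]
        · exact Or.inl ⟨mem_closedBall_zero_iff.mpr hzM,
            fun h => hzκ (Metric.ball_subset_closedBall h)⟩
      · exact absurd hz (hbig z (not_le.mp hzM).le ε (by rw [abs_of_pos hε0]; exact hε1.le))
    · intro z hz hz2
      rw [mem_closedBall_zero_iff, norm_mul, norm_inv, Complex.norm_real,
        Real.norm_of_nonneg hε0.le, inv_mul_le_iff₀ hε0] at hz2
      refine hz.2 ?_
      rw [mem_ball_iff_norm]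
      linarith
    · rw [Set.ncard_sdiff_singleton_of_mem (by exact ha), h.2.1]

theorem Polynomial.mem_and_derivative_ne_zero_of_signVariations_le {P : Polynomial ℝ} (hP : P ≠ 0)
    {S : Finset ℝ} (hcount : P.signVariations ≤ S.card) (hS : ∀ x ∈ S, 0 < x ∧ P.eval x = 0)
    {x : ℝ} (hx : 0 < x) (hPx : P.eval x = 0) : x ∈ S ∧ P.derivative.eval x ≠ 0 := by
  have hle : S.val ≤ P.roots.filter (0 < ·) := by
    refine (Multiset.le_iff_subset S.nodup).mpr fun y hy => ?_
    obtain ⟨h1, h2⟩ := hS y hy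
    exact Multiset.mem_filter.mpr ⟨(Polynomial.mem_roots hP).mpr h2, h1⟩
  have heq : S.val = P.roots.filter (0 < ·) := by
    refine Multiset.eq_of_le_of_card_le hle ?_
    rw [← Multiset.countP_eq_card_filter]
    exact (Polynomial.roots_countP_pos_le_signVariations P).trans hcount
  have hroot : x ∈ P.roots := (Polynomial.mem_roots hP).mpr hPx
  refine ⟨?_, fun hd => ?_⟩
  · rw [← Finset.mem_val, heq]
    exact Multiset.mem_filter.mpr ⟨hroot, hx⟩
  · have h1 := (Polynomial.one_lt_rootMultiplicity_iff_isRoot hP).mpr ⟨hPx, hd⟩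
    have h2 := Multiset.nodup_iff_count_le_one.mp (heq ▸ S.nodup) x
    rw [Multiset.count_filter_of_pos hx, Polynomial.count_roots] at h2
    omega

theorem Polynomial.leadingCoeff_monomial_add {d : ℕ} {c : ℝ} {Q : Polynomial ℝ} (hc : c ≠ 0)
    (hQ : Q.degree < d) : (Polynomial.monomial d c + Q).leadingCoeff = c := by
  rw [Polynomial.leadingCoeff_add_of_degree_lt', Polynomial.leadingCoeff_monomial]
  rwa [Polynomial.degree_monomial _ hc]

theorem Polynomial.signVariations_monomial_add {d : ℕ} {c : ℝ} {Q : Polynomial ℝ} (hc : c ≠ 0)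
    (hQ : Q.degree < d) : (Polynomial.monomial d c + Q).signVariations =
      Q.signVariations +
        if SignType.sign c = -SignType.sign Q.leadingCoeff then 1 else 0 := by
  have hlt : Q.degree < (Polynomial.monomial d c).degree := by
    rwa [Polynomial.degree_monomial _ hc]
  have h0 : Polynomial.monomial d c + Q ≠ 0 := by
    rw [← Polynomial.leadingCoeff_ne_zero, Polynomial.leadingCoeff_monomial_add hc hQ]
    exact hc
  rw [Polynomial.signVariations_eq_eraseLead_add_ite h0,
    Polynomial.leadingCoeff_monomial_add hc hQ,
    Polynomial.eraseLead_add_of_degree_lt_left hlt, Polynomial.eraseLead_monomial, zero_add]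

/-- The polynomial `x ^ N (x² - ε - 1) + a (x² - ε)`. -/
noncomputable def radialPoly (N : ℕ) (ε a : ℝ) : Polynomial ℝ :=
  Polynomial.monomial (N + 2) 1 + (Polynomial.monomial N (-(1 + ε)) +
    (Polynomial.monomial 2 a + Polynomial.monomial 0 (-(a * ε))))

theorem eval_radialPoly (N : ℕ) (ε a x : ℝ) :
    (radialPoly N ε a).eval x = x ^ N * (x ^ 2 - ε - 1) + a * (x ^ 2 - ε) := by
  simp only [radialPoly, Polynomial.eval_add, Polynomial.eval_monomial]
  ring

theorem mul_eval_derivative_radialPoly {N : ℕ} {ε a x : ℝ} (h : (radialPoly N ε a).eval x = 0) :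
    (x ^ 2 - ε) * (x * (radialPoly N ε a).derivative.eval x) =
      x ^ N * (2 * x ^ 2 - N * ((x ^ 2 - ε) * (1 - (x ^ 2 - ε)))) := by
  rw [eval_radialPoly] at h
  rcases N with _ | N
  · simp [radialPoly]
    linear_combination 2 * x ^ 2 * h
  · simp [radialPoly]
    linear_combination 2 * x ^ 2 * h

theorem radialPoly_ne_zero_and_signVariations {N : ℕ} (hN : 3 ≤ N) {ε a : ℝ} (hε : 0 < ε)
    (ha : a ≠ 0) : radialPoly N ε a ≠ 0 ∧
      (radialPoly N ε a).signVariations ≤ if 0 < a then 3 else 2 := by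
  have d0 : (Polynomial.monomial 0 (-(a * ε))).degree < ((2 : ℕ) : WithBot ℕ) :=
    (Polynomial.degree_monomial_le _ _).trans_lt (by norm_num)
  have d1 : (Polynomial.monomial 2 a + Polynomial.monomial 0 (-(a * ε))).degree <
      (N : WithBot ℕ) := by
    rw [Polynomial.degree_add_eq_left_of_degree_lt] <;> rw [Polynomial.degree_monomial _ ha]
    · exact_mod_cast hN
    · exact d0
  have hε1 : -(1 + ε) ≠ 0 := by linarith
  have d2 : (Polynomial.monomial N (-(1 + ε)) +
      (Polynomial.monomial 2 a + Polynomial.monomial 0 (-(a * ε)))).degree <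
      ((N + 2 : ℕ) : WithBot ℕ) := by
    rw [Polynomial.degree_add_eq_left_of_degree_lt] <;> rw [Polynomial.degree_monomial _ hε1]
    · exact_mod_cast (by omega : N < N + 2)
    · exact d1
  constructor
  · rw [← Polynomial.leadingCoeff_ne_zero, radialPoly,
      Polynomial.leadingCoeff_monomial_add one_ne_zero d2]
    exact one_ne_zero
  · rw [radialPoly, Polynomial.signVariations_monomial_add one_ne_zero d2,
      Polynomial.signVariations_monomial_add hε1 d1, Polynomial.signVariations_monomial_add ha d0,
      Polynomial.signVariations_monomial, Polynomial.leadingCoeff_monomial_add ha d0]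
    rcases lt_or_gt_of_ne ha with ha' | ha'
    · rw [Polynomial.leadingCoeff_monomial_add hε1 d1, sign_neg ha', sign_one,
        sign_neg (by linarith : -(1 + ε) < 0), if_neg (by decide : (-1 : SignType) ≠ - -1),
        if_neg ha'.not_gt]
      split_ifs <;> omega
    · rw [if_pos ha']
      split_ifs <;> omega

theorem exists_roots_radialPoly {N : ℕ} (hN : 3 ≤ N) : ∃ A e x₂ x₃ r₁ r₂ r₃ r₄ r₅ : ℝ,
    0 < A ∧ 0 < e ∧ x₂ ^ 2 = 1 - 1 / (2 * N) + e ^ 2 ∧ 1 / (2 * (N : ℝ)) < 1 ∧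
    x₃ ^ 2 = 1 + e ^ 2 ∧ e < r₁ ∧ r₁ < r₂ ∧ r₂ < x₂ ∧ x₂ < r₃ ∧ r₃ < x₃ ∧ 0 < r₄ ∧ r₄ < e ∧
    x₃ < r₅ ∧ (radialPoly N (e ^ 2) A).eval r₁ = 0 ∧ (radialPoly N (e ^ 2) A).eval r₂ = 0 ∧
    (radialPoly N (e ^ 2) A).eval r₃ = 0 ∧ (radialPoly N (e ^ 2) (-A)).eval r₄ = 0 ∧
    (radialPoly N (e ^ 2) (-A)).eval r₅ = 0 := by
  have hN3 : (3 : ℝ) ≤ N := by exact_mod_cast hN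
  obtain ⟨A, hA⟩ : ∃ A : ℝ, A = (1 / 2) ^ N / (2 * N) := ⟨_, rfl⟩
  have hA0 : 0 < A := by rw [hA]; positivity
  have hA1 : A < 1 / 16 := by
    rw [hA, div_lt_iff₀ (by positivity)]
    have : (1 / 2 : ℝ) ^ N ≤ (1 / 2) ^ 3 := pow_le_pow_of_le_one (by norm_num) (by norm_num) hN
    linarith
  have h2N : (8 : ℝ) ≤ 2 ^ N := by
    calc (8 : ℝ) = 2 ^ 3 := by norm_num
      _ ≤ 2 ^ N := pow_le_pow_right₀ (by norm_num) hN
  obtain ⟨e, he⟩ : ∃ e : ℝ, e = A / 2 ^ N := ⟨_, rfl⟩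
  have he0 : 0 < e := by rw [he]; positivity
  have he1 : e < 1 / 16 := by
    rw [he, div_lt_iff₀ (by positivity)]
    linarith
  have heA : e * 2 ^ N = A := by rw [he]; field_simp
  have hs₂ : 1 / (2 * (N : ℝ)) ≤ 1 / 6 := by
    apply one_div_le_one_div_of_le <;> linarith
  obtain ⟨x₂, hx₂0, hx₂⟩ : ∃ x : ℝ, 0 < x ∧ x ^ 2 = 1 - 1 / (2 * N) + e ^ 2 := by
    have : 0 < 1 - 1 / (2 * N) + e ^ 2 := by nlinarith
    exact ⟨√_, Real.sqrt_pos.mpr this, Real.sq_sqrt this.le⟩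
  obtain ⟨x₃, hx₃0, hx₃⟩ : ∃ x : ℝ, 0 < x ∧ x ^ 2 = 1 + e ^ 2 := by
    have : 0 < 1 + e ^ 2 := by positivity
    exact ⟨√_, Real.sqrt_pos.mpr this, Real.sq_sqrt this.le⟩
  have hNinv : 0 < 1 / (2 * (N : ℝ)) := by positivity
  have o1 : 2 * e < x₂ := by nlinarith
  have o2 : x₂ < x₃ := by nlinarith
  have o3 : x₃ < 2 := by nlinarith
  have hroot : ∀ a l u : ℝ, l < u →
      (radialPoly N (e ^ 2) a).eval l * (radialPoly N (e ^ 2) a).eval u < 0 →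
      ∃ x, l < x ∧ x < u ∧ (radialPoly N (e ^ 2) a).eval x = 0 := by
    intro a l u hlu h
    have hc := (radialPoly N (e ^ 2) a).continuous.continuousOn (s := Set.Icc l u)
    rcases mul_neg_iff.mp h with h | h
    · obtain ⟨x, hx, h0⟩ := intermediate_value_Ioo' hlu.le hc ⟨h.2, h.1⟩
      exact ⟨x, hx.1, hx.2, h0⟩
    · obtain ⟨x, hx, h0⟩ := intermediate_value_Ioo hlu.le hc h
      exact ⟨x, hx.1, hx.2, h0⟩
  have heN : 0 < e ^ N := by positivity
  have v1 : (radialPoly N (e ^ 2) A).eval e < 0 := by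
    rw [eval_radialPoly]
    linarith
  have v2 : 0 < (radialPoly N (e ^ 2) A).eval (2 * e) := by
    rw [eval_radialPoly]
    have h1 : (2 * e) ^ N ≤ A * e ^ 2 := by
      obtain ⟨k, rfl⟩ := Nat.exists_eq_add_of_le hN
      have h2 : e ^ k ≤ 1 := pow_le_one₀ he0.le (by linarith)
      calc (2 * e) ^ (3 + k) = 2 ^ (3 + k) * e * e ^ 2 * e ^ k := by ring
        _ ≤ 2 ^ (3 + k) * e * e ^ 2 * 1 := by gcongr
        _ = A * e ^ 2 := by rw [← heA]; ring
    have h3 : 0 < (2 * e) ^ N := by positivity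
    have h4 : 0 < (2 * e) ^ N * e ^ 2 := by positivity
    have h5 : 0 < A * e ^ 2 := by positivity
    nlinarith
  have v3 : (radialPoly N (e ^ 2) A).eval x₂ < 0 := by
    rw [eval_radialPoly, hx₂]
    have h1 : (1 / 2) ^ N ≤ x₂ ^ N := pow_le_pow_left₀ (by norm_num) (by nlinarith) N
    have h2 : A = (1 / 2) ^ N * (1 / (2 * N)) := by rw [hA]; ring
    have h3 := mul_le_mul_of_nonneg_right h1 hNinv.le
    nlinarith [mul_pos hA0 hNinv]
  have v4 : 0 < (radialPoly N (e ^ 2) A).eval x₃ := by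
    rw [eval_radialPoly, hx₃]
    linarith
  have w1 : 0 < (radialPoly N (e ^ 2) (-A)).eval 0 := by
    rw [eval_radialPoly, zero_pow (by omega)]
    have : 0 < A * e ^ 2 := by positivity
    linarith
  have w2 : (radialPoly N (e ^ 2) (-A)).eval e < 0 := by
    rw [eval_radialPoly]
    linarith
  have w3 : (radialPoly N (e ^ 2) (-A)).eval x₃ < 0 := by
    rw [eval_radialPoly, hx₃]
    linarith
  have w4 : 0 < (radialPoly N (e ^ 2) (-A)).eval 2 := by
    rw [eval_radialPoly]
    have h1 : e ^ 2 < 1 := by nlinarith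
    nlinarith [sq_nonneg e]
  obtain ⟨r₁, h₁, h₁', hr₁⟩ := hroot A e (2 * e) (by linarith) (mul_neg_of_neg_of_pos v1 v2)
  obtain ⟨r₂, h₂, h₂', hr₂⟩ := hroot A (2 * e) x₂ o1 (mul_neg_of_pos_of_neg v2 v3)
  obtain ⟨r₃, h₃, h₃', hr₃⟩ := hroot A x₂ x₃ o2 (mul_neg_of_neg_of_pos v3 v4)
  obtain ⟨r₄, h₄, h₄', hr₄⟩ := hroot (-A) 0 e he0 (mul_neg_of_pos_of_neg w1 w2)
  obtain ⟨r₅, h₅, h₅', hr₅⟩ := hroot (-A) x₃ 2 o3 (mul_neg_of_neg_of_pos w3 w4)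
  exact ⟨A, e, x₂, x₃, r₁, r₂, r₃, r₄, r₅, hA0, he0, hx₂, by linarith, hx₃, h₁, by linarith, h₂',
    h₃, h₃', h₄, h₄', h₅, hr₁, hr₂, hr₃, hr₄, hr₅⟩

theorem exists_radii {N : ℕ} (hN : 3 ≤ N) : ∃ (A ε : ℝ) (X : Finset ℝ), 0 < A ∧ 0 < ε ∧
    X.card = 5 ∧
    (∀ x, x ∈ X ↔ 0 < x ∧ A * |x ^ 2 - ε| = x ^ N * |x ^ 2 - ε - 1|) ∧
    (∀ x ∈ X, N * ((x ^ 2 - ε) * (1 - (x ^ 2 - ε))) ≠ 2 * x ^ 2) ∧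
    ∃ x ∈ X, 0 < N * ((x ^ 2 - ε) * (1 - (x ^ 2 - ε))) ∧
      N * ((x ^ 2 - ε) * (1 - (x ^ 2 - ε))) < x ^ 2 := by
  have hN0 : (0 : ℝ) < N := by exact_mod_cast (by omega : 0 < N)
  obtain ⟨A, e, x₂, x₃, r₁, r₂, r₃, r₄, r₅, hA0, he0, hx₂, hs₂, hx₃, h₁, h₂, h₂', h₃, h₃', h₄,
    h₄', h₅, hr₁, hr₂, hr₃, hr₄, hr₅⟩ := exists_roots_radialPoly hN
  have hε : 0 < e ^ 2 := by positivity
  have c₃ : ({r₁, r₂, r₃} : Finset ℝ).card = 3 :=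
    Finset.card_eq_three.mpr ⟨r₁, r₂, r₃, by linarith, by linarith, by linarith, rfl⟩
  have c₂ : ({r₄, r₅} : Finset ℝ).card = 2 := Finset.card_pair (by linarith)
  obtain ⟨hP0, hPv⟩ := radialPoly_ne_zero_and_signVariations hN hε hA0.ne'
  obtain ⟨hQ0, hQv⟩ := radialPoly_ne_zero_and_signVariations hN hε (neg_ne_zero.mpr hA0.ne')
  rw [if_pos hA0] at hPv
  rw [if_neg (by linarith)] at hQv
  have hP := fun x => Polynomial.mem_and_derivative_ne_zero_of_signVariations_le (x := x) hP0
    (hPv.trans c₃.ge) (by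
      simp only [Finset.mem_insert, Finset.mem_singleton]
      rintro y (rfl | rfl | rfl)
      exacts [⟨by linarith, hr₁⟩, ⟨by linarith, hr₂⟩, ⟨by linarith, hr₃⟩])
  have hQ := fun x => Polynomial.mem_and_derivative_ne_zero_of_signVariations_le (x := x) hQ0
    (hQv.trans c₂.ge) (by
      simp only [Finset.mem_insert, Finset.mem_singleton]
      rintro y (rfl | rfl)
      exacts [⟨h₄, hr₄⟩, ⟨by linarith, hr₅⟩])
  have hreg : ∀ x, 0 < x → (radialPoly N (e ^ 2) A).eval x = 0 →
      N * ((x ^ 2 - e ^ 2) * (1 - (x ^ 2 - e ^ 2))) ≠ 2 * x ^ 2 := by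
    intro x hx h0 h
    have hd := mul_eval_derivative_radialPoly h0
    rw [h, sub_self, mul_zero] at hd
    rcases mul_eq_zero.mp hd with h1 | h1
    · rw [eval_radialPoly, h1] at h0
      have : 0 < x ^ N := by positivity
      linarith
    · exact (mul_ne_zero hx.ne' (hP x hx h0).2) h1
  refine ⟨A, e ^ 2, {r₁, r₂, r₃} ∪ {r₄, r₅}, hA0, hε, ?_, fun x => ⟨fun hx => ?_, fun hx => ?_⟩,
    fun x hx => ?_, r₃, by simp, ?_, ?_⟩
  · rw [Finset.card_union_of_disjoint, c₃, c₂]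
    simp only [Finset.disjoint_insert_left, Finset.disjoint_singleton_left, Finset.mem_insert,
      Finset.mem_singleton, not_or]
    exact ⟨⟨by linarith, by linarith⟩, ⟨by linarith, by linarith⟩, ⟨by linarith, by linarith⟩⟩
  · have hx' : 0 < x ∧ ((radialPoly N (e ^ 2) A).eval x = 0 ∨
        (radialPoly N (e ^ 2) (-A)).eval x = 0) := by
      simp only [Finset.mem_union, Finset.mem_insert, Finset.mem_singleton] at hx
      rcases hx with (rfl | rfl | rfl) | (rfl | rfl)
      exacts [⟨by linarith, Or.inl hr₁⟩, ⟨by linarith, Or.inl hr₂⟩, ⟨by linarith, Or.inl hr₃⟩,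
        ⟨h₄, Or.inr hr₄⟩, ⟨by linarith, Or.inr hr₅⟩]
    refine ⟨hx'.1, ?_⟩
    rw [← abs_of_pos hA0, ← abs_of_pos (pow_pos hx'.1 N), ← abs_mul, ← abs_mul, abs_eq_abs]
    rw [eval_radialPoly, eval_radialPoly] at hx'
    rcases hx'.2 with h | h
    · right
      linarith
    · left
      linarith
  · obtain ⟨hx0, hx⟩ := hx
    rw [← abs_of_pos hA0, ← abs_of_pos (pow_pos hx0 N), ← abs_mul, ← abs_mul, abs_eq_abs] at hx
    rcases hx with h | h
    · refine Finset.mem_union_right _ (hQ x hx0 ?_).1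
      rw [eval_radialPoly]
      linarith
    · refine Finset.mem_union_left _ (hP x hx0 ?_).1
      rw [eval_radialPoly]
      linarith
  · simp only [Finset.mem_union, Finset.mem_insert, Finset.mem_singleton] at hx
    rcases hx with (rfl | rfl | rfl) | (rfl | rfl)
    · exact hreg x (by linarith) hr₁
    · exact hreg x (by linarith) hr₂
    · exact hreg x (by linarith) hr₃
    · have h1 : x ^ 2 < e ^ 2 := by gcongr
      have h2 : (x ^ 2 - e ^ 2) * (1 - (x ^ 2 - e ^ 2)) < 0 :=
        mul_neg_of_neg_of_pos (by linarith) (by linarith)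
      exact ((mul_neg_of_pos_of_neg hN0 h2).trans_le (by positivity)).ne
    · have h1 : x₃ ^ 2 < x ^ 2 := pow_lt_pow_left₀ h₅ (by linarith) two_ne_zero
      have h2 : (x ^ 2 - e ^ 2) * (1 - (x ^ 2 - e ^ 2)) < 0 :=
        mul_neg_of_pos_of_neg (by linarith) (by linarith)
      exact ((mul_neg_of_pos_of_neg hN0 h2).trans_le (by positivity)).ne
  · have h1 : x₂ ^ 2 < r₃ ^ 2 := pow_lt_pow_left₀ h₃ (by linarith) two_ne_zero
    have h2 : r₃ ^ 2 < x₃ ^ 2 := pow_lt_pow_left₀ h₃' (by linarith) two_ne_zero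
    have : 0 < (r₃ ^ 2 - e ^ 2) * (1 - (r₃ ^ 2 - e ^ 2)) :=
      mul_pos (by linarith) (by linarith)
    positivity
  · have h1 : x₂ ^ 2 < r₃ ^ 2 := pow_lt_pow_left₀ h₃ (by linarith) two_ne_zero
    have h2 : r₃ ^ 2 < x₃ ^ 2 := pow_lt_pow_left₀ h₃' (by linarith) two_ne_zero
    have h3 : N * (1 - (r₃ ^ 2 - e ^ 2)) < 1 / 2 := by
      have : 1 - (r₃ ^ 2 - e ^ 2) < 1 / (2 * N) := by linarith
      calc N * (1 - (r₃ ^ 2 - e ^ 2)) < N * (1 / (2 * N)) := by gcongr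
        _ = 1 / 2 := by field_simp
    have h4 := mul_le_mul_of_nonneg_left h3.le (by linarith : 0 ≤ r₃ ^ 2 - e ^ 2)
    have h5 : 0 < e ^ 2 := hε
    linarith

theorem finite_and_ncard_setOf_norm_mem_pow_eq {N : ℕ} (hN : 0 < N) (w : ℝ → ℝ) (X : Finset ℝ)
    (hX : ∀ x ∈ X, 0 < x ∧ |w x| = x ^ N) :
    {z : ℂ | ‖z‖ ∈ X ∧ z ^ N = (w ‖z‖ : ℝ)}.Finite ∧
      {z : ℂ | ‖z‖ ∈ X ∧ z ^ N = (w ‖z‖ : ℝ)}.ncard = X.card * N := by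
  induction X using Finset.induction_on with
  | empty => simp
  | insert a s ha ih =>
    obtain ⟨ih1, ih2⟩ := ih fun x hx => hX x (Finset.mem_insert_of_mem hx)
    obtain ⟨ha0, haw⟩ := hX a (Finset.mem_insert_self a s)
    have hnorm : ∀ z : ℂ, z ^ N = (w a : ℝ) → ‖z‖ = a := fun z hz => by
      have h := congrArg norm hz
      rw [norm_pow, Complex.norm_real, Real.norm_eq_abs, haw] at h
      exact (pow_left_inj₀ (norm_nonneg z) ha0.le hN.ne').mp h
    have hset : {z : ℂ | ‖z‖ ∈ insert a s ∧ z ^ N = (w ‖z‖ : ℝ)} =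
        {z : ℂ | z ^ N = (w a : ℝ)} ∪ {z : ℂ | ‖z‖ ∈ s ∧ z ^ N = (w ‖z‖ : ℝ)} := by
      ext z
      constructor
      · rintro ⟨h1, h2⟩
        rcases Finset.mem_insert.mp h1 with h | h
        · exact Or.inl (by rwa [h] at h2)
        · exact Or.inr ⟨h, h2⟩
      · rintro (h | h)
        · refine ⟨?_, ?_⟩ <;> rw [hnorm z h]
          exacts [Finset.mem_insert_self a s, h]
        · exact ⟨Finset.mem_insert_of_mem h.1, h.2⟩
    have hdisj : Disjoint {z : ℂ | z ^ N = (w a : ℝ)} {z : ℂ | ‖z‖ ∈ s ∧ z ^ N = (w ‖z‖ : ℝ)} := by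
      rw [Set.disjoint_left]
      intro z hz hz'
      exact ha (hnorm z hz ▸ hz'.1)
    have hwa : ((w a : ℝ) : ℂ) ≠ 0 := by
      intro h
      rw [Complex.ofReal_eq_zero.mp h, abs_zero] at haw
      exact (pow_pos ha0 N).ne haw
    rw [hset, Set.ncard_union_eq hdisj (finite_setOf_pow_eq hN _) ih1, ncard_setOf_pow_eq hN hwa,
      ih2, Finset.card_insert_of_notMem ha, add_mul, one_mul, add_comm]
    exact ⟨(finite_setOf_pow_eq hN _).union ih1, rfl⟩

/-- `lensMap p q X` has a nondegenerate sense-reversing zero where the analytic derivative does not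
vanish. -/
def HasReversingZero (p q : Polynomial ℂ) : Prop :=
  ∃ a, lensMap p q Polynomial.X a = 0 ∧
    starRingEnd ℂ a * q.derivative.eval a - p.derivative.eval a ≠ 0 ∧
    ‖starRingEnd ℂ a * q.derivative.eval a - p.derivative.eval a‖ < ‖q.eval a‖

theorem exists_norm_eq_pow_eq {N : ℕ} (hN : 0 < N) {x v : ℝ} (hx : 0 < x) (hv : |v| = x ^ N) :
    ∃ z : ℂ, ‖z‖ = x ∧ z ^ N = v := by
  obtain ⟨z, hz⟩ := IsAlgClosed.exists_pow_nat_eq (v : ℂ) hN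
  refine ⟨z, ?_, hz⟩
  have h := congrArg norm hz
  rw [norm_pow, Complex.norm_real, Real.norm_eq_abs, hv] at h
  exact (pow_left_inj₀ (norm_nonneg z) hx.le hN.ne').mp h

theorem exists_regular_of_perturbed_radii {N : ℕ} (hN : 0 < N) {A ε : ℝ} (hA : 0 < A) (hε : 0 < ε)
    {X : Finset ℝ} (hX : ∀ x, x ∈ X ↔ 0 < x ∧ A * |x ^ 2 - ε| = x ^ N * |x ^ 2 - ε - 1|)
    (hreg : ∀ x ∈ X, N * ((x ^ 2 - ε) * (1 - (x ^ 2 - ε))) ≠ 2 * x ^ 2)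
    (hrev : ∃ x ∈ X, 0 < N * ((x ^ 2 - ε) * (1 - (x ^ 2 - ε))) ∧
      N * ((x ^ 2 - ε) * (1 - (x ^ 2 - ε))) < x ^ 2) :
    ∃ p q : Polynomial ℂ, q.natDegree = N + 1 ∧ p.natDegree ≤ N + 1 ∧
      HasRegularZeros (lensMap p q Polynomial.X) (X.card * N) ∧ HasReversingZero p q := by
  obtain ⟨R, hR⟩ : ∃ R : Polynomial ℂ, R = Polynomial.X ^ N - Polynomial.C (A : ℂ) := ⟨_, rfl⟩
  have hRd : R.natDegree = N := by rw [hR, Polynomial.natDegree_X_pow_sub_C]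
  have hR0 : R ≠ 0 := by rw [hR]; exact Polynomial.X_pow_sub_C_ne_zero hN _
  obtain ⟨p, hp⟩ : ∃ p : Polynomial ℂ, p = Polynomial.X ^ N + Polynomial.C (ε : ℂ) * R := ⟨_, rfl⟩
  obtain ⟨q, hq⟩ : ∃ q : Polynomial ℂ, q = Polynomial.X * R := ⟨_, rfl⟩
  have hs1 : ∀ x ∈ X, x ^ 2 - ε - 1 ≠ 0 := fun x hx h => by
    obtain ⟨-, h2⟩ := (hX x).mp hx
    rw [h, abs_zero, mul_zero, show x ^ 2 - ε = 1 by linarith, abs_one, mul_one] at h2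
    exact hA.ne' h2
  have hs0 : ∀ x ∈ X, x ^ 2 - ε ≠ 0 := fun x hx h => by
    obtain ⟨h1, h2⟩ := (hX x).mp hx
    rw [h] at h2
    have := pow_pos h1 N
    norm_num at h2
    exact this.ne h2
  have hval : ∀ z : ℂ, lensMap p q Polynomial.X z =
      ((‖z‖ ^ 2 - ε - 1 : ℝ) : ℂ) * z ^ N - ((A * (‖z‖ ^ 2 - ε) : ℝ) : ℂ) := fun z => by
    have h := Complex.conj_mul' z
    simp only [lensMap, hp, hq, hR, Polynomial.eval_X, Polynomial.eval_mul, Polynomial.eval_add,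
      Polynomial.eval_sub, Polynomial.eval_pow, Polynomial.eval_C]
    push_cast
    linear_combination (z ^ N - A) * h
  obtain ⟨w, hw⟩ : ∃ w : ℝ → ℝ, w = fun x => A * (x ^ 2 - ε) / (x ^ 2 - ε - 1) := ⟨_, rfl⟩
  have hwX : ∀ x ∈ X, 0 < x ∧ |w x| = x ^ N := fun x hx => by
    obtain ⟨h1, h2⟩ := (hX x).mp hx
    refine ⟨h1, ?_⟩
    rw [hw, abs_div, abs_mul, abs_of_pos hA, h2,
      mul_div_cancel_right₀ _ (abs_ne_zero.mpr (hs1 x hx))]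
  have hzero : {z | lensMap p q Polynomial.X z = 0} =
      {z : ℂ | ‖z‖ ∈ X ∧ z ^ N = (w ‖z‖ : ℝ)} := by
    ext z
    simp only [Set.mem_ofPred_eq, hval, sub_eq_zero, hw]
    constructor
    · intro h
      have hz : 0 < ‖z‖ := by
        rw [norm_pos_iff]
        rintro rfl
        rw [zero_pow hN.ne', mul_zero, eq_comm, Complex.ofReal_eq_zero] at h
        simp [hA.ne', hε.ne'] at h
      have hm : ‖z‖ ∈ X := by
        refine (hX _).mpr ⟨hz, ?_⟩
        have h' := congrArg norm h
        rw [norm_mul, norm_pow, Complex.norm_real, Complex.norm_real, Real.norm_eq_abs,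
          Real.norm_eq_abs, abs_mul, abs_of_pos hA] at h'
        linarith
      refine ⟨hm, ?_⟩
      rw [Complex.ofReal_div, eq_div_iff (by exact_mod_cast hs1 _ hm), mul_comm, h]
    · rintro ⟨hm, h⟩
      rw [h, Complex.ofReal_div, mul_div_cancel₀ _ (by exact_mod_cast hs1 _ hm)]
  have hder : ∀ z : ℂ, lensMap p q Polynomial.X z = 0 →
      ‖z‖ * |‖z‖ ^ 2 - ε - 1| *
        ‖starRingEnd ℂ z * q.derivative.eval z - p.derivative.eval z‖ =
        A * |‖z‖ ^ 2 - N * ((‖z‖ ^ 2 - ε) * (1 - (‖z‖ ^ 2 - ε)))| ∧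
      ‖z‖ * |‖z‖ ^ 2 - ε - 1| * ‖q.eval z‖ = A * ‖z‖ ^ 2 := fun z hz => by
    rw [hval] at hz
    push_cast at hz
    have h := Complex.conj_mul' z
    obtain ⟨M, rfl⟩ := Nat.exists_eq_add_of_lt hN
    rw [zero_add] at *
    have e1 : z * ((‖z‖ ^ 2 - ε - 1 : ℝ) : ℂ) *
        (starRingEnd ℂ z * q.derivative.eval z - p.derivative.eval z) = (A : ℂ) *
        ((‖z‖ ^ 2 - (M + 1 : ℕ) * ((‖z‖ ^ 2 - ε) * (1 - (‖z‖ ^ 2 - ε))) : ℝ) : ℂ) := by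
      simp [hp, hq, hR]
      linear_combination (‖z‖ ^ 2 - ε - 1 : ℂ) * (z ^ (M + 1) - A + (M + 1) * z ^ (M + 1)) * h +
        (‖z‖ ^ 2 + (M + 1) * (‖z‖ ^ 2 - ε - 1 : ℂ)) * hz
    have e2 : z * ((‖z‖ ^ 2 - ε - 1 : ℝ) : ℂ) * q.eval z = (A : ℂ) * z ^ 2 := by
      simp only [hq, hR, Polynomial.eval_X, Polynomial.eval_mul, Polynomial.eval_sub,
        Polynomial.eval_pow, Polynomial.eval_C]
      push_cast
      linear_combination z ^ 2 * hz
    have n1 := congrArg norm e1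
    have n2 := congrArg norm e2
    simp only [norm_mul, norm_pow, Complex.norm_real, Real.norm_eq_abs, abs_of_pos hA] at n1 n2
    exact ⟨n1, n2⟩
  have hfac : ∀ z : ℂ, ‖z‖ ∈ X → 0 < ‖z‖ * |‖z‖ ^ 2 - ε - 1| := fun z hm =>
    mul_pos ((hX _).mp hm).1 (abs_pos.mpr (hs1 _ hm))
  obtain ⟨h1, h2⟩ := finite_and_ncard_setOf_norm_mem_pow_eq hN w X hwX
  rw [← hzero] at h1 h2
  refine ⟨p, q, ?_, ?_, ⟨h1, h2, fun z hz => isInvertible_fderiv_lensMap_X fun heq => ?_⟩, ?_⟩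
  · rw [hq, Polynomial.natDegree_X_mul hR0, hRd]
  · rw [hp]
    refine Polynomial.natDegree_add_le_of_degree_le ?_
      ((Polynomial.natDegree_C_mul_le _ _).trans (by omega))
    rw [Polynomial.natDegree_X_pow]
    omega
  · have hm := (hzero.subset hz).1
    obtain ⟨d1, d2⟩ := hder z hz
    rw [heq, d2] at d1
    have d3 := mul_left_cancel₀ hA.ne' d1
    have hN' : (N : ℝ) ≠ 0 := by exact_mod_cast hN.ne'
    rcases abs_choice (‖z‖ ^ 2 - N * ((‖z‖ ^ 2 - ε) * (1 - (‖z‖ ^ 2 - ε)))) with h | h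
    · have h5 : N * ((‖z‖ ^ 2 - ε) * (1 - (‖z‖ ^ 2 - ε))) = 0 := by linarith
      refine mul_ne_zero hN' (mul_ne_zero (hs0 _ hm) fun h6 => hs1 _ hm ?_) h5
      linarith
    · exact hreg _ hm (by linarith)
  · obtain ⟨x, hx, t1, t2⟩ := hrev
    obtain ⟨z, rfl, hz⟩ := exists_norm_eq_pow_eq hN (hwX x hx).1 (hwX x hx).2
    have hz0 : lensMap p q Polynomial.X z = 0 := hzero.superset ⟨hx, hz⟩
    obtain ⟨d1, d2⟩ := hder z hz0
    rw [abs_of_pos (sub_pos.mpr t2)] at d1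
    refine ⟨z, hz0, fun h0 => ?_, ?_⟩
    · rw [h0, norm_zero, mul_zero, eq_comm] at d1
      exact mul_ne_zero hA.ne' (sub_pos.mpr t2).ne' d1
    · refine lt_of_mul_lt_mul_left ?_ (hfac z hx).le
      rw [d1, d2]
      gcongr
      linarith

theorem exists_regular_of_radii {K c : ℕ} {A : ℝ} (hA : 0 < A) (hA1 : A ≠ 1)
    {X : Finset ℝ} (hc : X.card * (K + 2) + 1 = c)
    (hX : ∀ x, x ∈ X ↔ 0 < x ∧ A * x ^ 2 = x ^ (K + 2) * |x ^ 2 - 1|)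
    (hreg : ∀ x ∈ X, (K + 2) * (1 - x ^ 2) ≠ 2)
    (hrev : ∃ x ∈ X, 0 < (K + 2) * (1 - x ^ 2) ∧ (K + 2) * (1 - x ^ 2) < 2 ∧
      (K + 2) * (1 - x ^ 2) ≠ 1) :
    ∃ p q : Polynomial ℂ, q.natDegree = K + 2 ∧ p.natDegree ≤ K + 2 ∧
      HasRegularZeros (lensMap p q Polynomial.X) c ∧ HasReversingZero p q := by
  obtain ⟨p, hp⟩ : ∃ p : Polynomial ℂ, p = Polynomial.X ^ (K + 1) := ⟨_, rfl⟩
  obtain ⟨q, hq⟩ : ∃ q : Polynomial ℂ, q = Polynomial.X ^ (K + 2) - Polynomial.C (A : ℂ) :=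
    ⟨_, rfl⟩
  have hs1 : ∀ x ∈ X, x ^ 2 - 1 ≠ 0 := fun x hx h => by
    obtain ⟨h1, h2⟩ := (hX x).mp hx
    rw [h, abs_zero, mul_zero] at h2
    exact (by positivity : A * x ^ 2 ≠ 0) h2
  have hval : ∀ z : ℂ, z * lensMap p q Polynomial.X z =
      ((‖z‖ ^ 2 - 1 : ℝ) : ℂ) * z ^ (K + 2) - ((A * ‖z‖ ^ 2 : ℝ) : ℂ) := fun z => by
    have h := Complex.conj_mul' z
    simp only [lensMap, hp, hq, Polynomial.eval_X, Polynomial.eval_sub, Polynomial.eval_pow,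
      Polynomial.eval_C]
    push_cast
    linear_combination (z ^ (K + 2) - A) * h
  obtain ⟨w, hw⟩ : ∃ w : ℝ → ℝ, w = fun x => A * x ^ 2 / (x ^ 2 - 1) := ⟨_, rfl⟩
  have hwX : ∀ x ∈ X, 0 < x ∧ |w x| = x ^ (K + 2) := fun x hx => by
    obtain ⟨h1, h2⟩ := (hX x).mp hx
    refine ⟨h1, ?_⟩
    rw [hw, abs_div, abs_of_pos (by positivity : 0 < A * x ^ 2), h2,
      mul_div_cancel_right₀ _ (abs_ne_zero.mpr (hs1 x hx))]
  have hzero : {z | lensMap p q Polynomial.X z = 0} =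
      insert 0 {z : ℂ | ‖z‖ ∈ X ∧ z ^ (K + 2) = (w ‖z‖ : ℝ)} := by
    ext z
    rw [Set.mem_insert_iff, Set.mem_ofPred_eq, Set.mem_ofPred_eq]
    rcases eq_or_ne z 0 with rfl | hz
    · simp [lensMap, hp]
    have hz' : 0 < ‖z‖ := norm_pos_iff.mpr hz
    rw [← mul_right_inj' hz, mul_zero, hval, sub_eq_zero, or_iff_right hz, hw]
    constructor
    · intro h
      have hm : ‖z‖ ∈ X := by
        refine (hX _).mpr ⟨hz', ?_⟩
        have h' := congrArg norm h
        rw [norm_mul, norm_pow, Complex.norm_real, Complex.norm_real, Real.norm_eq_abs,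
          Real.norm_eq_abs, abs_of_pos (by positivity : 0 < A * ‖z‖ ^ 2)] at h'
        linarith
      refine ⟨hm, ?_⟩
      rw [Complex.ofReal_div, eq_div_iff (by exact_mod_cast hs1 _ hm), mul_comm, h]
    · rintro ⟨hm, h⟩
      rw [h, Complex.ofReal_div, mul_div_cancel₀ _ (by exact_mod_cast hs1 _ hm)]
  have hder : ∀ z : ℂ, lensMap p q Polynomial.X z = 0 →
      ‖z‖ ^ 2 * |‖z‖ ^ 2 - 1| *
        ‖starRingEnd ℂ z * q.derivative.eval z - p.derivative.eval z‖ =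
        A * ‖z‖ ^ 2 * |1 - (K + 2) * (1 - ‖z‖ ^ 2)| ∧
      ‖z‖ ^ 2 * |‖z‖ ^ 2 - 1| * ‖q.eval z‖ = A * ‖z‖ ^ 2 := fun z hz => by
    have hv := hval z
    rw [hz, mul_zero] at hv
    push_cast at hv
    have h := Complex.conj_mul' z
    have e1 : z ^ 2 * ((‖z‖ ^ 2 - 1 : ℝ) : ℂ) *
        (starRingEnd ℂ z * q.derivative.eval z - p.derivative.eval z) = (A : ℂ) *
        (‖z‖ : ℂ) ^ 2 * ((1 - (K + 2) * (1 - ‖z‖ ^ 2) : ℝ) : ℂ) := by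
      simp [hp, hq]
      linear_combination (‖z‖ ^ 2 - 1 : ℂ) * (K + 2) * z ^ (K + 2) * h -
        (1 - (K + 2) * (1 - ‖z‖ ^ 2 : ℂ)) * hv
    have e2 : z ^ 2 * ((‖z‖ ^ 2 - 1 : ℝ) : ℂ) * q.eval z = (A : ℂ) * z ^ 2 := by
      simp only [hq, Polynomial.eval_X, Polynomial.eval_sub, Polynomial.eval_pow,
        Polynomial.eval_C]
      push_cast
      linear_combination -z ^ 2 * hv
    have n1 := congrArg norm e1
    have n2 := congrArg norm e2
    simp only [norm_mul, norm_pow, Complex.norm_real, Real.norm_eq_abs, abs_of_pos hA,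
      abs_norm] at n1 n2
    exact ⟨n1, n2⟩
  obtain ⟨h1, h2⟩ := finite_and_ncard_setOf_norm_mem_pow_eq (Nat.succ_pos (K + 1)) w X hwX
  refine ⟨p, q, ?_, ?_, ⟨hzero ▸ h1.insert 0, ?_, fun z hz =>
    isInvertible_fderiv_lensMap_X fun heq => ?_⟩, ?_⟩
  · rw [hq, Polynomial.natDegree_X_pow_sub_C]
  · rw [hp, Polynomial.natDegree_X_pow]
    omega
  · rw [hzero, Set.ncard_insert_of_notMem _ h1, h2, hc]
    intro h
    simpa using (hwX _ h.1).1
  · rcases hzero.subset hz with rfl | ⟨hm, -⟩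
    · have hqn : ‖q.eval 0‖ = A := by simp [hq, hA.le]
      rw [hqn] at heq
      rcases K with _ | K
      · simp [hp] at heq
        exact hA1 heq.symm
      · simp [hp] at heq
        exact hA.ne heq
    · obtain ⟨d1, d2⟩ := hder z hz
      have hz0 := ((hX _).mp hm).1
      rw [heq, d2, eq_comm] at d1
      have d3 : |1 - (K + 2) * (1 - ‖z‖ ^ 2)| = 1 :=
        (mul_eq_left₀ (by positivity : A * ‖z‖ ^ 2 ≠ 0)).mp d1
      rcases abs_choice (1 - (K + 2) * (1 - ‖z‖ ^ 2)) with h | h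
      · have h5 : (K + 2 : ℝ) * (1 - ‖z‖ ^ 2) = 0 := by linarith
        refine mul_ne_zero (by positivity : (K + 2 : ℝ) ≠ 0) (fun h6 => hs1 _ hm ?_) h5
        linarith
      · exact hreg _ hm (by linarith)
  · obtain ⟨x, hx, t1, t2, t3⟩ := hrev
    obtain ⟨z, rfl, hz⟩ :=
      exists_norm_eq_pow_eq (Nat.succ_pos (K + 1)) (hwX x hx).1 (hwX x hx).2
    have hx0 := (hwX _ hx).1
    have hz0 : lensMap p q Polynomial.X z = 0 := hzero.superset (Or.inr ⟨hx, hz⟩)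
    obtain ⟨d1, d2⟩ := hder z hz0
    refine ⟨z, hz0, fun h0 => ?_, ?_⟩
    · rw [h0, norm_zero, mul_zero, eq_comm] at d1
      exact mul_ne_zero (by positivity : A * ‖z‖ ^ 2 ≠ 0)
        (abs_ne_zero.mpr (sub_ne_zero.mpr t3.symm)) d1
    · have hfac : 0 < ‖z‖ ^ 2 * |‖z‖ ^ 2 - 1| := by
        have := abs_pos.mpr (hs1 _ hx)
        positivity
      refine lt_of_mul_lt_mul_left ?_ hfac.le
      rw [d1, d2]
      exact mul_lt_of_lt_one_right (by positivity) (abs_lt.mpr ⟨by linarith, by linarith⟩)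

theorem exists_maximal_regular {n : ℕ} (hn : 2 ≤ n) :
    ∃ p q : Polynomial ℂ, q.natDegree = n ∧ p.natDegree ≤ n ∧
      HasRegularZeros (lensMap p q Polynomial.X) (5 * n - 5) ∧ HasReversingZero p q := by
  obtain rfl | rfl | h4 : n = 2 ∨ n = 3 ∨ 4 ≤ n := by omega
  · refine exists_regular_of_radii (K := 0) (A := 24 / 25) (X := {1 / 5, 7 / 5}) (by norm_num)
      (by norm_num) (by rw [Finset.card_pair (by norm_num)]) (fun x => ?_) ?_
      ⟨1 / 5, by simp, by norm_num, by norm_num, by norm_num⟩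
    · simp only [Finset.mem_insert, Finset.mem_singleton]
      constructor
      · rintro (rfl | rfl) <;> norm_num [abs_of_pos, abs_of_neg]
      · rintro ⟨h0, h⟩
        have h' : |x ^ 2 - 1| = 24 / 25 := by
          refine mul_left_cancel₀ (pow_pos h0 2).ne' ?_
          rw [← h]
          ring
        rcases abs_choice (x ^ 2 - 1) with ha | ha
        · right
          nlinarith
        · left
          nlinarith
    · simp only [Finset.mem_insert, Finset.mem_singleton]
      rintro x (rfl | rfl) <;> norm_num
  · refine exists_regular_of_radii (K := 1) (A := 120 / 343) (X := {3 / 7, 5 / 7, 8 / 7})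
      (by norm_num) (by norm_num) ?_ (fun x => ?_) ?_
      ⟨5 / 7, by simp, by norm_num, by norm_num, by norm_num⟩
    · rw [Finset.card_eq_three.mpr
        ⟨_, _, _, by norm_num, by norm_num, by norm_num, rfl⟩]
    · simp only [Finset.mem_insert, Finset.mem_singleton]
      constructor
      · rintro (rfl | rfl | rfl) <;> norm_num [abs_of_pos, abs_of_neg]
      · rintro ⟨h0, h⟩
        have h' : x * |x ^ 2 - 1| = 120 / 343 := by
          refine mul_left_cancel₀ (pow_pos h0 2).ne' ?_
          linarith
        rcases abs_choice (x ^ 2 - 1) with ha | ha <;> rw [ha] at h'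
        · have h1 : (x - 8 / 7) * ((x + 3 / 7) * (x + 5 / 7)) = 0 := by linarith
          have h2 : (x + 3 / 7) * (x + 5 / 7) ≠ 0 := by positivity
          exact Or.inr (Or.inr (sub_eq_zero.mp ((mul_eq_zero.mp h1).resolve_right h2)))
        · have h1 : (x - 3 / 7) * (x - 5 / 7) * (x + 8 / 7) = 0 := by linarith
          have h2 : x + 8 / 7 ≠ 0 := by positivity
          rcases mul_eq_zero.mp ((mul_eq_zero.mp h1).resolve_right h2) with h3 | h3
          · exact Or.inl (sub_eq_zero.mp h3)
          · exact Or.inr (Or.inl (sub_eq_zero.mp h3))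
    · simp only [Finset.mem_insert, Finset.mem_singleton]
      rintro x (rfl | rfl | rfl) <;> norm_num
  · obtain ⟨N, rfl⟩ : ∃ N, n = N + 1 := ⟨n - 1, by omega⟩
    obtain ⟨A, ε, X, hA, hε, hc, hX, hreg, hrev⟩ := exists_radii (N := N) (by omega)
    obtain ⟨p, q, h1, h2, h3, h4⟩ :=
      exists_regular_of_perturbed_radii (by omega) hA hε hX hreg hrev
    rw [hc] at h3
    exact ⟨p, q, h1, h2, h3, h4⟩

theorem exists_regular_sub_seven {n : ℕ} (hn : 3 ≤ n) :
    ∃ p q : Polynomial ℂ, q.natDegree = n ∧ p.natDegree ≤ n ∧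
      HasRegularZeros (lensMap p q Polynomial.X) (5 * n - 7) := by
  obtain ⟨k, rfl⟩ : ∃ k, n = k + 1 := ⟨n - 1, by omega⟩
  obtain ⟨p, q, hq, hp, h, a, ha, ha0, ha1⟩ := exists_maximal_regular (n := k) (by omega)
  have hq0 : q ≠ 0 := by
    rintro rfl
    simp at hq
    omega
  obtain ⟨p', q', hq', hp', h'⟩ := h.exists_add_pole hq0 (hp.trans hq.ge) ha ha0 ha1
  rw [hq] at hq'
  refine ⟨p', q', hq', hp'.trans hq'.le, ?_⟩
  rwa [show 5 * (k + 1) - 7 = 5 * k - 5 + 3 by omega]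

theorem exists_ncard_zeros_add {p q r : Polynomial ℂ} {c : ℕ} (hq : q ≠ 0)
    (hpq : p.natDegree ≤ q.natDegree) (hfin : {z | lensMap p q r z = 0}.Finite)
    (hcard : {z | lensMap p q r z = 0}.ncard = c) (k : ℕ) :
    ∃ p' q' : Polynomial ℂ, q'.natDegree = q.natDegree + k ∧ p'.natDegree ≤ q.natDegree + k ∧
      {z | lensMap p' q' r z = 0}.Finite ∧ {z | lensMap p' q' r z = 0}.ncard = c + k := by
  obtain ⟨S, hS, hSk⟩ := hfin.infinite_compl.exists_subset_card_eq k
  obtain ⟨s, hs⟩ : ∃ s : Polynomial ℂ, s = ∏ a ∈ S, (Polynomial.X - Polynomial.C a) := ⟨_, rfl⟩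
  have hs0 : s.Monic :=
    hs ▸ Polynomial.monic_prod_of_monic _ _ fun a _ => Polynomial.monic_X_sub_C a
  have hsd : s.natDegree = k := by rw [hs, Polynomial.natDegree_finsetProd_X_sub_C_eq_card, hSk]
  have hset : {z | lensMap (p * s) (q * s) r z = 0} = {z | lensMap p q r z = 0} ∪ S := by
    ext z
    have : lensMap (p * s) (q * s) r z = lensMap p q r z * ∏ a ∈ S, (z - a) := by
      simp only [lensMap, Polynomial.eval_mul, hs, Polynomial.eval_prod, Polynomial.eval_sub,
        Polynomial.eval_X, Polynomial.eval_C]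
      ring
    rw [Set.mem_union, Set.mem_ofPred_eq, Set.mem_ofPred_eq, this, mul_eq_zero,
      Finset.prod_eq_zero_iff]
    simp [sub_eq_zero]
  refine ⟨p * s, q * s, ?_, ?_, ?_, ?_⟩
  · rw [Polynomial.natDegree_mul hq hs0.ne_zero, hsd]
  · exact Polynomial.natDegree_mul_le.trans (by omega)
  · exact hset ▸ hfin.union S.finite_toSet
  · rw [hset, Set.ncard_union_eq (Set.subset_compl_iff_disjoint_left.mp hS) hfin S.finite_toSet,
      hcard, Set.ncard_coe_finset, hSk]

theorem exists_ncard_zeros_zero_X_pow {m : ℕ} (hm : 1 ≤ m) (e : ℕ) :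
    ∃ r : Polynomial ℂ, r.natDegree = m ∧
      {z | lensMap 0 (Polynomial.X ^ e) r z = 0}.Finite ∧
      {z | lensMap 0 (Polynomial.X ^ e) r z = 0}.ncard = m := by
  have hset : {z | lensMap 0 (Polynomial.X ^ e)
      (∏ k ∈ Finset.range m, (Polynomial.X - Polynomial.C (k : ℂ))) z = 0} =
      (Nat.cast : ℕ → ℂ) '' (Finset.range m : Set ℕ) := by
    ext z
    rw [Set.mem_ofPred_eq, lensMap, Polynomial.eval_zero, sub_zero, mul_eq_zero,
      Polynomial.eval_prod, Finset.prod_eq_zero_iff]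
    have hk : ∀ k : ℕ, (Polynomial.X - Polynomial.C (k : ℂ)).eval (starRingEnd ℂ z) = 0 ↔
        (k : ℂ) = z := fun k => by
      rw [Polynomial.eval_sub, Polynomial.eval_X, Polynomial.eval_C, sub_eq_zero,
        ← (starRingEnd ℂ).injective.eq_iff, Complex.conj_conj, map_natCast, eq_comm]
    simp only [hk, Polynomial.eval_pow, Polynomial.eval_X, Set.mem_image, Finset.mem_coe]
    refine or_iff_left_of_imp fun h => ⟨0, Finset.mem_range.mpr hm, ?_⟩
    rw [eq_zero_of_pow_eq_zero h, Nat.cast_zero]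
  refine ⟨_, by rw [Polynomial.natDegree_finsetProd_X_sub_C_eq_card, Finset.card_range],
    hset ▸ (Finset.finite_toSet _).image _, ?_⟩
  rw [hset, Set.ncard_image_of_injective _ Nat.cast_injective, Set.ncard_coe_finset,
    Finset.card_range]

/-- For integers `n ≥ 2`, `m ≥ 1` and each `0 ≤ j ≤ 2n - 2`, there exist
polynomials `p, q, r` over `ℂ` with `deg q = n`, `deg p ≤ n`, `deg r = m` such that the
harmonically splitting lens type equation `r(conj z) q(z) = p(z)` has exactly
`n + m - 2 + 2j` solutions. -/
theorem stmt_13 (n m : ℕ) (hn : 2 ≤ n) (hm : 1 ≤ m) (j : ℕ) (hj : j ≤ 2 * n - 2) :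
    ∃ p q r : Polynomial ℂ, q.natDegree = n ∧ p.natDegree ≤ n ∧ r.natDegree = m ∧
      ({z : ℂ | r.eval (starRingEnd ℂ z) * q.eval z = p.eval z}).Finite ∧
      ({z : ℂ | r.eval (starRingEnd ℂ z) * q.eval z = p.eval z}).ncard
        = n + m - 2 + 2 * j := by
  have hset : ∀ p q r : Polynomial ℂ, {z : ℂ | r.eval (starRingEnd ℂ z) * q.eval z = p.eval z} =
      {z | lensMap p q r z = 0} := fun p q r => by simp only [lensMap, sub_eq_zero]
  simp only [hset]
  have of_regular : ∀ (k c d : ℕ), 1 ≤ d → d + k = n → c + (m - 1) + k = n + m - 2 + 2 * j →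
      (∃ p q : Polynomial ℂ, q.natDegree = d ∧ p.natDegree ≤ d ∧
        HasRegularZeros (lensMap p q Polynomial.X) c) →
      ∃ p q r : Polynomial ℂ, q.natDegree = n ∧ p.natDegree ≤ n ∧ r.natDegree = m ∧
        {z | lensMap p q r z = 0}.Finite ∧
        {z | lensMap p q r z = 0}.ncard = n + m - 2 + 2 * j := by
    rintro k c d hd rfl hcount ⟨p, q, rfl, hp, h⟩
    have hq0 : q ≠ 0 := by
      rintro rfl
      simp at hd
    obtain ⟨r, hr, h1, h2, -⟩ := h.exists_natDegree_eq hq0 hp hm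
    obtain ⟨p', q', hq', hp', h3, h4⟩ := exists_ncard_zeros_add hq0 hp h1 h2 k
    exact ⟨p', q', r, hq', hp', hr, h3, h4.trans hcount⟩
  rcases Nat.lt_or_ge j 2 with hj2 | hj2
  · obtain ⟨r, hr, h1, h2⟩ := exists_ncard_zeros_zero_X_pow hm (2 - 2 * j)
    obtain ⟨p', q', hq', hp', h3, h4⟩ := exists_ncard_zeros_add
      (pow_ne_zero _ Polynomial.X_ne_zero) (by simp) h1 h2 (n - (2 - 2 * j))
    rw [Polynomial.natDegree_X_pow, show 2 - 2 * j + (n - (2 - 2 * j)) = n by omega] at hq' hp'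
    exact ⟨p', q', r, hq', hp', hr, h3, by omega⟩
  · obtain ⟨k, hk | hk⟩ := Nat.even_or_odd' (2 * n - 2 - j)
    · obtain ⟨p, q, h1, h2, h3, -⟩ := exists_maximal_regular (n := n - k) (by omega)
      exact of_regular k _ _ (by omega) (by omega) (by omega) ⟨p, q, h1, h2, h3⟩
    · exact of_regular k _ _ (by omega) (by omega) (by omega)
        (exists_regular_sub_seven (n := n - k) (by omega))
end

section
/- Let n > m ≥ 2 be integers and let a be an integer with 0 ≤ a ≤ m − 2. Then the set {z ∈ ℂ | (z^(n−a) · conj(z)^(m−a) − 1) · (z^a − 2) · (conj(z)^a − 3) = 0} is finite and has exactly n − m + 2a elements. -/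
/-- A nonzero complex number has exactly `k` distinct `k`-th roots, for `k ≠ 0`. -/
theorem Complex.finite_and_ncard_setOf_pow_eq {k : ℕ} (hk : k ≠ 0) {c : ℂ} (hc : c ≠ 0) :
    {z : ℂ | z ^ k = c}.Finite ∧ {z : ℂ | z ^ k = c}.ncard = k := by
  have hζ := Complex.isPrimitiveRoot_exp k hk
  have hset : {z : ℂ | z ^ k = c} = ((Polynomial.nthRoots k c).toFinset : Set ℂ) := by
    ext z
    simp [Polynomial.mem_nthRoots (Nat.pos_of_ne_zero hk)]
  rw [hset]
  refine ⟨Finset.finite_toSet _, ?_⟩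
  rw [Set.ncard_coe_finset, Multiset.toFinset_card_of_nodup (hζ.nthRoots_nodup hc),
    hζ.card_nthRoots, if_pos (IsAlgClosed.exists_pow_nat_eq c (Nat.pos_of_ne_zero hk))]

/-- The mixed equation `z ^ p * conj z ^ q = 1` with `q < p` has the same solutions as
`z ^ (p - q) = 1`. -/
theorem Complex.pow_mul_conj_pow_eq_one_iff {p q : ℕ} (h : q < p) (z : ℂ) :
    z ^ p * (starRingEnd ℂ z) ^ q = 1 ↔ z ^ (p - q) = 1 := by
  have key : ‖z‖ = 1 → z ^ p * (starRingEnd ℂ z) ^ q = z ^ (p - q) := fun hz => by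
    have hzz : z * starRingEnd ℂ z = 1 := by
      rw [Complex.mul_conj, Complex.normSq_eq_norm_sq, hz]
      norm_num
    nth_rewrite 1 [← Nat.sub_add_cancel h.le]
    rw [pow_add, mul_assoc, ← mul_pow, hzz, one_pow, mul_one]
  constructor
  · intro hz
    rw [← key, hz]
    have hn := congrArg norm hz
    rw [norm_mul, norm_pow, norm_pow, RCLike.norm_conj, ← pow_add, norm_one] at hn
    exact (pow_eq_one_iff_of_nonneg (norm_nonneg z) (by omega)).1 hn
  · intro hz
    rw [key (Complex.norm_eq_one_of_pow_eq_one hz (by omega)), hz]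

/-- For integers `n > m ≥ 2` and `0 ≤ a ≤ m - 2`, the zero set of
`(z^(n-a) conj(z)^(m-a) - 1)(z^a - 2)(conj(z)^a - 3)` is finite with exactly
`n - m + 2a` elements. -/
theorem stmt_14 (n m a : ℕ) (hm : 2 ≤ m) (hnm : m < n) (ha : a ≤ m - 2) :
    ({z : ℂ | (z ^ (n - a) * (starRingEnd ℂ z) ^ (m - a) - 1) * (z ^ a - 2)
        * ((starRingEnd ℂ z) ^ a - 3) = 0}).Finite ∧
    ({z : ℂ | (z ^ (n - a) * (starRingEnd ℂ z) ^ (m - a) - 1) * (z ^ a - 2)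
        * ((starRingEnd ℂ z) ^ a - 3) = 0}).ncard = n - m + 2 * a := by
  have hconj (z : ℂ) : (starRingEnd ℂ z) ^ a = 3 ↔ z ^ a = 3 := by
    rw [← map_pow, ← (starRingEnd ℂ).injective.eq_iff (a := z ^ a), map_ofNat]
  have hset : {z : ℂ | (z ^ (n - a) * (starRingEnd ℂ z) ^ (m - a) - 1) * (z ^ a - 2)
        * ((starRingEnd ℂ z) ^ a - 3) = 0}
      = ({z : ℂ | z ^ (n - m) = 1} ∪ {z : ℂ | z ^ a = 2}) ∪ {z : ℂ | z ^ a = 3} := by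
    ext z
    simp only [Set.mem_ofPred_eq, Set.mem_union, mul_eq_zero, sub_eq_zero, hconj,
      Complex.pow_mul_conj_pow_eq_one_iff (show m - a < n - a by omega),
      show n - a - (m - a) = n - m by omega]
  rw [hset]
  have roots {c : ℂ} (hc : c ≠ 0) (hc1 : c ≠ 1) :
      {z : ℂ | z ^ a = c}.Finite ∧ {z : ℂ | z ^ a = c}.ncard = a := by
    rcases eq_or_ne a 0 with rfl | ha0
    · simp [hc1.symm]
    · exact Complex.finite_and_ncard_setOf_pow_eq ha0 hc
  obtain ⟨hf1, hc1⟩ :=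
    Complex.finite_and_ncard_setOf_pow_eq (show n - m ≠ 0 by omega) (one_ne_zero (α := ℂ))
  obtain ⟨hf2, hc2⟩ := roots (c := 2) (by norm_num) (by norm_num)
  obtain ⟨hf3, hc3⟩ := roots (c := 3) (by norm_num) (by norm_num)
  have hnorm {z : ℂ} (hz : z ^ (n - m) = 1) : ‖z ^ a‖ = 1 := by
    rw [norm_pow, Complex.norm_eq_one_of_pow_eq_one hz (by omega), one_pow]
  have hd12 : Disjoint {z : ℂ | z ^ (n - m) = 1} {z : ℂ | z ^ a = 2} := by
    refine Set.disjoint_left.2 fun z (h1 : z ^ (n - m) = 1) (h2 : z ^ a = 2) => ?_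
    have := hnorm h1
    norm_num [h2] at this
  have hd3 : Disjoint ({z : ℂ | z ^ (n - m) = 1} ∪ {z : ℂ | z ^ a = 2}) {z : ℂ | z ^ a = 3} := by
    refine Set.disjoint_left.2 fun z h (h3 : z ^ a = 3) => ?_
    rcases h with (h1 : z ^ (n - m) = 1) | (h2 : z ^ a = 2)
    · have := hnorm h1
      norm_num [h3] at this
    · norm_num [h3] at h2
  refine ⟨(hf1.union hf2).union hf3, ?_⟩
  rw [Set.ncard_union_eq hd3 (hf1.union hf2) hf3, Set.ncard_union_eq hd12 hf1 hf2, hc1, hc2, hc3]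
  omega
end

section
/- Let n > m ≥ 1 with n ≥ 2. For every integer k of the form k = n − m + 2j with 0 ≤ j ≤ 2n + m − 3 (i.e. k ∈ {n−m, n−m+2, ..., 5n+m−6}), there exists a finitely supported family of coefficients c : ℕ × ℕ → ℂ with c(ν,μ) = 0 unless ν ≤ n and μ ≤ m, and with c(n,m) ≠ 0, such that the set {z ∈ ℂ | Σ_{ν,μ} c(ν,μ) · z^ν · conj(z)^μ = 0} is finite and has exactly k elements. -/
open ComplexConjugate

/-- `f` is a mixed polynomial function of holomorphic degree `n` and anti-holomorphic degree `m`. -/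
def IsMixed (n m : ℕ) (f : ℂ → ℂ) : Prop :=
  ∃ c : ℕ → ℕ → ℂ, c n m ≠ 0 ∧ ∀ z, f z = ∑ i ∈ Finset.range (n + 1),
    ∑ j ∈ Finset.range (m + 1), c i j * z ^ i * conj z ^ j

/-- Some mixed polynomial of degrees `n` and `m` has exactly `k` zeros. -/
def RealizesZeros (n m k : ℕ) : Prop :=
  ∃ f, IsMixed n m f ∧ {z : ℂ | f z = 0}.Finite ∧ {z : ℂ | f z = 0}.ncard = k

theorem IsMixed.comp_conj {n m : ℕ} {f : ℂ → ℂ} (hf : IsMixed n m f) :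
    IsMixed m n (fun z => f (conj z)) := by
  obtain ⟨c, hc, h⟩ := hf
  refine ⟨fun i j => c j i, hc, fun z => ?_⟩
  simp only [h]
  rw [Finset.sum_comm]
  simp only [Complex.conj_conj, mul_right_comm]

theorem IsMixed.sub_const_mul {n m : ℕ} {f : ℂ → ℂ} (hf : IsMixed n m f) (a : ℂ) :
    IsMixed (n + 1) m (fun z => (z - a) * f z) := by
  obtain ⟨c, hc, h⟩ := hf
  refine ⟨fun i j => (if i = 0 then 0 else c (i - 1) j) - a * (if i ≤ n then c i j else 0),
    by simpa using hc, fun z => ?_⟩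
  simp only [sub_mul, Finset.sum_sub_distrib]
  congr 1
  · rw [Finset.sum_range_succ', h, Finset.mul_sum]
    simp only [Finset.mul_sum, Nat.succ_ne_zero, if_false, if_true, zero_mul,
      Finset.sum_const_zero, add_zero, Nat.add_sub_cancel, pow_succ]
    refine Finset.sum_congr rfl fun i _ => Finset.sum_congr rfl fun j _ => ?_
    ring
  · rw [Finset.sum_range_succ, h, Finset.mul_sum]
    simp only [Finset.mul_sum, Nat.not_succ_le_self, if_false, mul_zero, zero_mul,
      Finset.sum_const_zero, add_zero]
    refine Finset.sum_congr rfl fun i hi => Finset.sum_congr rfl fun j _ => ?_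
    rw [if_pos (Nat.lt_succ_iff.1 (Finset.mem_range.1 hi))]
    ring

theorem RealizesZeros.symm {n m k : ℕ} (h : RealizesZeros n m k) : RealizesZeros m n k := by
  obtain ⟨f, hf, hfin, hk⟩ := h
  have : {z : ℂ | f (conj z) = 0} = (starRingEnd ℂ) '' {z : ℂ | f z = 0} := by
    ext z
    refine ⟨fun hz => ⟨conj z, hz, Complex.conj_conj z⟩, ?_⟩
    rintro ⟨w, hw, rfl⟩
    simpa using hw
  refine ⟨_, hf.comp_conj, ?_, ?_⟩
  · rw [this]
    exact hfin.image _
  · rw [this, Set.ncard_image_of_injective _ (starRingEnd ℂ).injective, hk]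

theorem RealizesZeros.succ_succ {n m k : ℕ} (h : RealizesZeros n m k) :
    RealizesZeros (n + 1) m (k + 1) := by
  obtain ⟨f, hf, hfin, hk⟩ := h
  obtain ⟨a, ha⟩ := hfin.exists_notMem
  have : {z : ℂ | (z - a) * f z = 0} = insert a {z : ℂ | f z = 0} := by
    ext z
    simp [sub_eq_zero]
  refine ⟨_, hf.sub_const_mul a, ?_, ?_⟩
  · rw [this]
    exact hfin.insert a
  · rw [this, Set.ncard_insert_of_notMem ha hfin, hk]

theorem RealizesZeros.succ {n m k : ℕ} (h : RealizesZeros n m k) (hk0 : 1 ≤ k) :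
    RealizesZeros (n + 1) m k := by
  obtain ⟨f, hf, hfin, hk⟩ := h
  obtain ⟨a, ha⟩ := Set.nonempty_of_ncard_ne_zero (s := {z : ℂ | f z = 0}) (by lia)
  have : {z : ℂ | (z - a) * f z = 0} = {z : ℂ | f z = 0} := by
    ext z
    simp only [Set.mem_ofPred_eq, mul_eq_zero, sub_eq_zero, or_iff_right_iff_imp]
    rintro rfl
    exact ha
  refine ⟨_, hf.sub_const_mul a, ?_, ?_⟩ <;> rw [this] <;> assumption

theorem RealizesZeros.add_antiholomorphic {n k : ℕ} (h : RealizesZeros n 1 k) (hk : 1 ≤ k)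
    (d i : ℕ) (hi : i ≤ d) : RealizesZeros n (1 + d) (k + i) := by
  induction d generalizing i with
  | zero =>
    obtain rfl : i = 0 := by lia
    exact h
  | succ d ih =>
    rcases Nat.eq_zero_or_pos i with rfl | hi0
    · exact ((ih 0 (by lia)).symm.succ (by lia)).symm
    · obtain ⟨i, rfl⟩ : ∃ i', i = i' + 1 := ⟨i - 1, by lia⟩
      exact (ih i (by lia)).symm.succ_succ.symm

theorem realizesZeros_one_one_zero : RealizesZeros 1 1 0 := by
  have key : ∀ z : ℂ, 1 + z * conj z ≠ 0 := fun z hz => by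
    rw [Complex.mul_conj] at hz
    have h1 := congrArg Complex.re hz
    simp only [Complex.add_re, Complex.one_re, Complex.ofReal_re, Complex.zero_re] at h1
    linarith [Complex.normSq_nonneg z]
  refine ⟨fun z => 1 + z * conj z, ⟨fun i j => if i = j then 1 else 0, by simp, fun z => ?_⟩,
    ?_, ?_⟩
  · simp [Finset.sum_range_succ]
  · simp [key]
  · simp [key]

theorem realizesZeros_small {n k : ℕ} (hk : 1 ≤ k) (hkn : k < n) : RealizesZeros n 1 k := by
  induction n generalizing k with
  | zero => lia
  | succ n ih =>
    rcases Nat.lt_or_ge k n with h | h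
    · exact (ih hk h).succ hk
    · rcases Nat.lt_or_ge 1 k with h2 | h2
      · obtain ⟨k, rfl⟩ : ∃ i', k = i' + 1 := ⟨k - 1, by lia⟩
        exact (ih (by lia) (by lia)).succ_succ
      · obtain rfl : k = 1 := by lia
        obtain rfl : n = 1 := by lia
        exact realizesZeros_one_one_zero.succ_succ

/-- If the zeros of `f` are the points `a + b √3 i` with `(a, b)` in a finite set of integer
points, then their number is the cardinality of that set. -/
theorem IsMixed.realizesZeros_card {n m : ℕ} {f : ℂ → ℂ} (hf : IsMixed n m f) (S : Finset (ℤ × ℤ))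
    {k : ℕ} (hk : S.card = k)
    (hS : ∀ x y w : ℝ, w ^ 2 = 3 * y ^ 2 → (w = 0 ↔ y = 0) →
      (f ⟨x, w⟩ = 0 ↔ ∃ p ∈ S, x = p.1 ∧ y = p.2)) :
    RealizesZeros n m k := by
  have h3 : √3 ≠ 0 := by positivity
  let e : ℤ × ℤ → ℂ := fun p => ⟨p.1, √3 * p.2⟩
  have he : Function.Injective e := fun p q h => by
    have h1 : (p.1 : ℝ) = q.1 := congrArg Complex.re h
    have h2 : (p.2 : ℝ) = q.2 := mul_left_cancel₀ h3 (congrArg Complex.im h)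
    exact Prod.ext (by exact_mod_cast h1) (by exact_mod_cast h2)
  have : {z : ℂ | f z = 0} = (S.image e : Finset ℂ) := by
    ext z
    have h := hS z.re (z.im / √3) z.im
      (by rw [div_pow, Real.sq_sqrt (by norm_num)]; ring) (by simp [h3])
    rw [Set.mem_ofPred_eq, h, Finset.mem_coe, Finset.mem_image]
    refine exists_congr fun p => and_congr_right fun _ => ?_
    rw [Complex.ext_iff, eq_comm]
    refine and_congr_right fun _ => ?_
    rw [div_eq_iff h3, mul_comm, eq_comm]
  refine ⟨f, hf, ?_, ?_⟩
  · rw [this]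
    exact Finset.finite_toSet _
  · rw [this, Set.ncard_coe_finset, Finset.card_image_of_injective _ he, hk]

theorem isMixed_two_one (α β : ℂ) :
    IsMixed 2 1 (fun z => z * (z * conj z + α) + β * conj z) :=
  ⟨fun i j => (if i = 2 ∧ j = 1 then 1 else 0) + (if i = 1 ∧ j = 0 then α else 0) +
    (if i = 0 ∧ j = 1 then β else 0), by simp, fun z => by simp [Finset.sum_range_succ]; ring⟩

theorem isMixed_three_one (α β γ : ℂ) :
    IsMixed 3 1 (fun z => z ^ 2 * (z * conj z + β * (z + conj z) + α) + γ * conj z) :=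
  ⟨fun i j => (if i = 3 ∧ j = 1 then 1 else 0) + (if i = 3 ∧ j = 0 then β else 0) +
    (if i = 2 ∧ j = 1 then β else 0) + (if i = 2 ∧ j = 0 then α else 0) +
    (if i = 0 ∧ j = 1 then γ else 0), by simp, fun z => by simp [Finset.sum_range_succ]; ring⟩

theorem two_one_eq_zero_iff (α β x y w : ℝ) (hw : w ^ 2 = 3 * y ^ 2) (h0 : w = 0 ↔ y = 0) :
    (⟨x, w⟩ : ℂ) * (⟨x, w⟩ * conj (⟨x, w⟩ : ℂ) + α) + β * conj (⟨x, w⟩ : ℂ) = 0 ↔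
      (x = 0 ∨ x ^ 2 + 3 * y ^ 2 + α + β = 0) ∧ (y = 0 ∨ x ^ 2 + 3 * y ^ 2 + α - β = 0) := by
  have : (⟨x, w⟩ : ℂ) * (⟨x, w⟩ * conj (⟨x, w⟩ : ℂ) + α) + β * conj (⟨x, w⟩ : ℂ) =
      ⟨x * (x ^ 2 + w ^ 2 + α + β), w * (x ^ 2 + w ^ 2 + α - β)⟩ := by
    apply Complex.ext <;> simp <;> ring
  rw [this, Complex.ext_iff, hw]
  simp [h0]

theorem realizesZeros_two_one_three : RealizesZeros 2 1 3 := by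
  refine (isMixed_two_one (0 : ℝ) (-1 : ℝ)).realizesZeros_card {(0, 0), (1, 0), (-1, 0)}
    (by decide) fun x y w hw h0 => ?_
  rw [two_one_eq_zero_iff _ _ _ _ _ hw h0]
  simp only [Finset.mem_insert, Finset.mem_singleton, exists_eq_or_imp, exists_eq_left]
  push_cast
  constructor
  · rintro ⟨h1, h2⟩
    have hy : y = 0 := h2.resolve_right (by nlinarith [sq_nonneg x, sq_nonneg y])
    subst hy
    rcases h1 with h | h
    · exact Or.inl ⟨h, rfl⟩
    · have : (x - 1) * (x + 1) = 0 := by linarith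
      grind
  · grind

theorem realizesZeros_two_one_five : RealizesZeros 2 1 5 := by
  refine (isMixed_two_one (-2 : ℝ) (1 : ℝ)).realizesZeros_card
    {(0, 0), (1, 0), (-1, 0), (0, 1), (0, -1)} (by decide) fun x y w hw h0 => ?_
  rw [two_one_eq_zero_iff _ _ _ _ _ hw h0]
  simp only [Finset.mem_insert, Finset.mem_singleton, exists_eq_or_imp, exists_eq_left]
  push_cast
  constructor
  · rintro ⟨h1 | h1, h2 | h2⟩
    · grind
    · have : (y - 1) * (y + 1) = 0 := by rw [h1] at h2; linarith
      grind
    · have : (x - 1) * (x + 1) = 0 := by rw [h2] at h1; linarith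
      grind
    · linarith
  · grind

theorem three_one_eq_zero_iff (α β γ x y w : ℝ) (hγ : γ ≠ 0) (hw : w ^ 2 = 3 * y ^ 2)
    (h0 : w = 0 ↔ y = 0) :
    (⟨x, w⟩ : ℂ) ^ 2 * (⟨x, w⟩ * conj (⟨x, w⟩ : ℂ) + β * (⟨x, w⟩ + conj (⟨x, w⟩ : ℂ)) + α) +
      γ * conj (⟨x, w⟩ : ℂ) = 0 ↔
      y = 0 ∧ (x = 0 ∨ x ^ 3 + 2 * β * x ^ 2 + α * x + γ = 0) ∨
      (y = x ∨ y = -x) ∧ (x = 0 ∨ (-2 * x) ^ 3 - β * (-2 * x) ^ 2 + α * (-2 * x) + γ = 0) := by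
  set U := x ^ 2 + w ^ 2 + 2 * β * x + α with hU
  have : (⟨x, w⟩ : ℂ) ^ 2 * (⟨x, w⟩ * conj (⟨x, w⟩ : ℂ) + β * (⟨x, w⟩ + conj (⟨x, w⟩ : ℂ)) + α) +
      γ * conj (⟨x, w⟩ : ℂ) = ⟨(x ^ 2 - w ^ 2) * U + γ * x, w * (2 * x * U - γ)⟩ := by
    rw [hU]
    apply Complex.ext <;> simp [pow_two] <;> ring
  rw [this, Complex.ext_iff]
  simp only [Complex.zero_re, Complex.zero_im, mul_eq_zero, h0]
  rw [hw] at hU ⊢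
  constructor
  · rintro ⟨h1, h2 | h2⟩
    · left
      refine ⟨h2, ?_⟩
      rw [← mul_eq_zero]
      rw [hU, h2] at h1
      linear_combination h1
    · right
      have hU0 : U ≠ 0 := by
        rintro h
        rw [h] at h2
        exact hγ (by linarith)
      have hyx : (y - x) * (y + x) = 0 := by
        refine (mul_eq_zero.1 (?_ : U * ((y - x) * (y + x)) = 0)).resolve_left hU0
        linear_combination (-1 / 3) * h1 - x / 3 * h2
      have hyx2 : y ^ 2 = x ^ 2 := by linear_combination hyx
      refine ⟨?_, ?_⟩
      · rcases mul_eq_zero.1 hyx with h | h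
        · exact Or.inl (by linarith)
        · exact Or.inr (by linarith)
      · right
        rw [hyx2] at hU
        rw [hU] at h2
        linear_combination -h2
  · rintro (⟨rfl, h⟩ | ⟨h, h'⟩)
    · refine ⟨?_, Or.inl rfl⟩
      rw [← mul_eq_zero] at h
      rw [hU]
      linear_combination h
    · have hyx2 : y ^ 2 = x ^ 2 := by rcases h with rfl | rfl <;> ring
      rcases h' with rfl | h'
      · have : y = 0 := by simpa using hyx2
        simp [this]
      · rw [hyx2] at hU ⊢
        have h2 : 2 * x * U - γ = 0 := by rw [hU]; linear_combination -h'
        exact ⟨by linear_combination -x * h2, Or.inr h2⟩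

theorem realizesZeros_three_one_ten : RealizesZeros 3 1 10 := by
  refine (isMixed_three_one (-28 : ℝ) (0 : ℝ) (48 : ℝ)).realizesZeros_card
    {(0, 0), (2, 0), (4, 0), (-6, 0), (-1, -1), (-1, 1), (-2, -2), (-2, 2), (3, 3), (3, -3)}
    (by decide) fun x y w hw h0 => ?_
  rw [three_one_eq_zero_iff _ _ _ _ _ _ (by norm_num) hw h0]
  simp only [Finset.mem_insert, Finset.mem_singleton, exists_eq_or_imp, exists_eq_left]
  push_cast
  have e1 : x ^ 3 + 2 * 0 * x ^ 2 + -28 * x + 48 = 0 ↔ x = 2 ∨ x = 4 ∨ x = -6 := by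
    rw [show x ^ 3 + 2 * 0 * x ^ 2 + -28 * x + 48 = (x - 2) * ((x - 4) * (x - -6)) by ring]
    simp only [mul_eq_zero, sub_eq_zero]
  have e2 : (-2 * x) ^ 3 - 0 * (-2 * x) ^ 2 + -28 * (-2 * x) + 48 = 0 ↔
      x = -1 ∨ x = -2 ∨ x = 3 := by
    rw [show (-2 * x) ^ 3 - 0 * (-2 * x) ^ 2 + -28 * (-2 * x) + 48 =
      -8 * ((x - -1) * ((x - -2) * (x - 3))) by ring]
    simp only [mul_eq_zero, sub_eq_zero]
    norm_num
  rw [e1, e2]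
  constructor
  · rintro (⟨rfl, rfl | rfl | rfl | rfl⟩ | ⟨rfl | rfl, rfl | rfl | rfl | rfl⟩) <;> norm_num
  · rintro (⟨rfl, rfl⟩ | ⟨rfl, rfl⟩ | ⟨rfl, rfl⟩ | ⟨rfl, rfl⟩ | ⟨rfl, rfl⟩ | ⟨rfl, rfl⟩ |
      ⟨rfl, rfl⟩ | ⟨rfl, rfl⟩ | ⟨rfl, rfl⟩ | ⟨rfl, rfl⟩) <;> norm_num

theorem realizesZeros_three_one_eight : RealizesZeros 3 1 8 := by
  refine (isMixed_three_one (-120 : ℝ) (-18 : ℝ) (-1600 : ℝ)).realizesZeros_card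
    {(0, 0), (40, 0), (10, 10), (10, -10), (4, 4), (4, -4), (-5, -5), (-5, 5)}
    (by decide) fun x y w hw h0 => ?_
  rw [three_one_eq_zero_iff _ _ _ _ _ _ (by norm_num) hw h0]
  simp only [Finset.mem_insert, Finset.mem_singleton, exists_eq_or_imp, exists_eq_left]
  push_cast
  have e1 : x ^ 3 + 2 * -18 * x ^ 2 + -120 * x + -1600 = 0 ↔ x = 40 := by
    rw [show x ^ 3 + 2 * -18 * x ^ 2 + -120 * x + -1600 = (x - 40) * ((x + 2) ^ 2 + 36) by ring]
    rw [mul_eq_zero, sub_eq_zero, or_iff_left (by positivity)]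
  have e2 : (-2 * x) ^ 3 - -18 * (-2 * x) ^ 2 + -120 * (-2 * x) + -1600 = 0 ↔
      x = 10 ∨ x = 4 ∨ x = -5 := by
    rw [show (-2 * x) ^ 3 - -18 * (-2 * x) ^ 2 + -120 * (-2 * x) + -1600 =
      -8 * ((x - 10) * ((x - 4) * (x - -5))) by ring]
    simp only [mul_eq_zero, sub_eq_zero]
    norm_num
  rw [e1, e2]
  constructor
  · rintro (⟨rfl, rfl | rfl⟩ | ⟨rfl | rfl, rfl | rfl | rfl | rfl⟩) <;> norm_num
  · rintro (⟨rfl, rfl⟩ | ⟨rfl, rfl⟩ | ⟨rfl, rfl⟩ | ⟨rfl, rfl⟩ | ⟨rfl, rfl⟩ | ⟨rfl, rfl⟩ |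
      ⟨rfl, rfl⟩ | ⟨rfl, rfl⟩) <;> norm_num

theorem ncard_eq_two_of_no_three {S : Set ℝ} {x y : ℝ} (hx : x ∈ S) (hy : y ∈ S) (hxy : x < y)
    (h : ∀ a ∈ S, ∀ b ∈ S, ∀ c ∈ S, a < b → b < c → False) : S.ncard = 2 := by
  have : S = {x, y} := by
    ext w
    refine ⟨fun hw => ?_, by rintro (rfl | rfl) <;> assumption⟩
    rcases lt_trichotomy w x with h1 | h1 | h1
    · exact (h _ hw _ hx _ hy h1 hxy).elim
    · exact Or.inl h1
    · rcases lt_trichotomy w y with h2 | h2 | h2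
      · exact (h _ hx _ hw _ hy h1 h2).elim
      · exact Or.inr h2
      · exact (h _ hx _ hy _ hw hxy h2).elim
  rw [this, Set.ncard_pair hxy.ne]

theorem ncard_eq_three_of_no_four {S : Set ℝ} {x y z : ℝ} (hx : x ∈ S) (hy : y ∈ S) (hz : z ∈ S)
    (hxy : x < y) (hyz : y < z)
    (h : ∀ a ∈ S, ∀ b ∈ S, ∀ c ∈ S, ∀ d ∈ S, a < b → b < c → c < d → False) : S.ncard = 3 := by
  have : S = {x, y, z} := by
    ext w
    refine ⟨fun hw => ?_, by rintro (rfl | rfl | rfl) <;> assumption⟩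
    rcases lt_trichotomy w x with h1 | h1 | h1
    · exact (h _ hw _ hx _ hy _ hz h1 hxy hyz).elim
    · exact Or.inl h1
    · rcases lt_trichotomy w y with h2 | h2 | h2
      · exact (h _ hx _ hw _ hy _ hz h1 h2 hyz).elim
      · exact Or.inr (Or.inl h2)
      · rcases lt_trichotomy w z with h3 | h3 | h3
        · exact (h _ hx _ hy _ hw _ hz hxy h2 h3).elim
        · exact Or.inr (Or.inr h3)
        · exact (h _ hx _ hy _ hz _ hw hxy hyz h3).elim
  rw [this, Set.ncard_eq_three]
  exact ⟨x, y, z, hxy.ne, (hxy.trans hyz).ne, hyz.ne, rfl⟩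

/-- Points on the rays spanned by finitely many unit complex numbers can be counted ray by ray. -/
theorem ncard_rays (W : Finset ℂ) (hW : ∀ ω ∈ W, ‖ω‖ = 1) (R : ℂ → Set ℝ)
    (hpos : ∀ ω ∈ W, ∀ r ∈ R ω, 0 < r) (hfin : ∀ ω ∈ W, (R ω).Finite) :
    {z : ℂ | ∃ ω ∈ W, ∃ r ∈ R ω, z = r * ω}.Finite ∧
      {z : ℂ | ∃ ω ∈ W, ∃ r ∈ R ω, z = r * ω}.ncard = ∑ ω ∈ W, (R ω).ncard := by
  induction W using Finset.induction_on with
  | empty => simp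
  | insert a W ha ih =>
    obtain ⟨ih1, ih2⟩ := ih (fun ω h => hW ω (Finset.mem_insert_of_mem h))
      (fun ω h => hpos ω (Finset.mem_insert_of_mem h))
      (fun ω h => hfin ω (Finset.mem_insert_of_mem h))
    have hWa := hW a (Finset.mem_insert_self a W)
    have ha0 : a ≠ 0 := norm_ne_zero_iff.1 (by rw [hWa]; exact one_ne_zero)
    have hinj : Function.Injective (fun r : ℝ => (r : ℂ) * a) := fun r s h =>
      Complex.ofReal_injective (mul_right_cancel₀ ha0 h)
    have himg := (hfin a (Finset.mem_insert_self a W)).image (fun r : ℝ => (r : ℂ) * a)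
    have hU : {z : ℂ | ∃ ω ∈ insert a W, ∃ r ∈ R ω, z = r * ω} =
        (fun r : ℝ => (r : ℂ) * a) '' R a ∪ {z : ℂ | ∃ ω ∈ W, ∃ r ∈ R ω, z = r * ω} := by
      ext z
      simp only [Finset.mem_insert, exists_eq_or_imp, Set.mem_union, Set.mem_image,
        Set.mem_ofPred_eq, eq_comm (a := z)]
    have hdisj : Disjoint ((fun r : ℝ => (r : ℂ) * a) '' R a)
        {z : ℂ | ∃ ω ∈ W, ∃ r ∈ R ω, z = r * ω} := by
      rw [Set.disjoint_left]
      rintro _ ⟨r, hr, rfl⟩ ⟨ω, hω, s, hs, h⟩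
      have hr0 := hpos a (Finset.mem_insert_self a W) r hr
      have hs0 := hpos ω (Finset.mem_insert_of_mem hω) s hs
      have hn := congrArg norm h
      simp only [norm_mul, hWa, hW ω (Finset.mem_insert_of_mem hω), Complex.norm_real, mul_one,
        Real.norm_of_nonneg hr0.le, Real.norm_of_nonneg hs0.le] at hn
      subst hn
      have := mul_left_cancel₀ (Complex.ofReal_ne_zero.2 hr0.ne') h
      exact ha (this ▸ hω)
    rw [hU, Finset.sum_insert ha, Set.ncard_union_eq hdisj himg ih1, ih2,
      Set.ncard_image_of_injective _ hinj]
    exact ⟨himg.union ih1, rfl⟩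

/-- The restriction of the mixed polynomial `rayPoly` to a ray. -/
noncomputable def radial (p : ℕ) (c q σ B r : ℝ) : ℝ :=
  σ * r ^ (p + 2) * (c - q * r ^ 2) + p + B * r - (2 * p + 3) * r ^ 2

theorem continuous_radial (p : ℕ) (c q σ B : ℝ) : Continuous (radial p c q σ B) := by
  unfold radial
  fun_prop

theorem exists_zero_of_pos_of_neg {f : ℝ → ℝ} (hf : Continuous f) {a b : ℝ} (hab : a < b)
    (ha : 0 < f a) (hb : f b < 0) : ∃ r, a < r ∧ r < b ∧ f r = 0 := by
  obtain ⟨r, hr, h⟩ := intermediate_value_Ioo' hab.le hf.continuousOn ⟨hb, ha⟩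
  exact ⟨r, hr.1, hr.2, h⟩

theorem exists_zero_of_neg_of_pos {f : ℝ → ℝ} (hf : Continuous f) {a b : ℝ} (hab : a < b)
    (ha : f a < 0) (hb : 0 < f b) : ∃ r, a < r ∧ r < b ∧ f r = 0 := by
  obtain ⟨r, hr, h⟩ := intermediate_value_Ioo hab.le hf.continuousOn ⟨ha, hb⟩
  exact ⟨r, hr.1, hr.2, h⟩

/-- The Rolle theorem for `radial p c q σ B r / r ^ (p + 2)`. -/
theorem radial_rolle (p : ℕ) (c q σ B : ℝ) {x y : ℝ} (hx0 : 0 < x) (hxy : x < y)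
    (hx : radial p c q σ B x = 0) (hy : radial p c q σ B y = 0) :
    ∃ z, x < z ∧ z < y ∧
      2 * σ * q * z ^ (p + 4) + (p + 2) * p + (p + 1) * B * z - p * (2 * p + 3) * z ^ 2 = 0 := by
  have hd : ∀ r : ℝ, HasDerivAt (radial p c q σ B)
      (σ * ((p + 2) * r ^ (p + 1)) * (c - q * r ^ 2) + σ * r ^ (p + 2) * (-(q * (2 * r))) + B -
        (2 * p + 3) * (2 * r)) r := fun r => by
    have h1 := (hasDerivAt_pow (p + 2) r).const_mul σ
    have h2 := ((hasDerivAt_pow 2 r).const_mul q).const_sub c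
    have h3 := (hasDerivAt_id r).const_mul B
    have h4 := (hasDerivAt_pow 2 r).const_mul ((2 : ℝ) * p + 3)
    refine ((((h1.mul h2).add_const (p : ℝ)).add h3).sub h4).congr_deriv ?_
    push_cast
    simp
  have hq : ∀ r ∈ Set.Ioo x y, HasDerivAt (fun r => radial p c q σ B r / r ^ (p + 2)) _ r :=
    fun r hr => (hd r).div (hasDerivAt_pow (p + 2) r) (pow_ne_zero _ (hx0.trans hr.1).ne')
  obtain ⟨z, hz, h⟩ := exists_hasDerivAt_eq_zero hxy
    ((continuous_radial p c q σ B).continuousOn.div (continuous_pow _).continuousOn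
      fun r hr => pow_ne_zero _ (hx0.trans_le hr.1).ne') (by simp [hx, hy]) hq
  have hz0 : 0 < z := hx0.trans hz.1
  refine ⟨z, hz.1, hz.2, ?_⟩
  rw [div_eq_zero_iff, or_iff_left (by positivity), radial] at h
  push_cast at h
  refine (mul_eq_zero.1 (?_ : z ^ (p + 1) * _ = 0)).resolve_left (by positivity)
  linear_combination -h

theorem radial_no_three {p : ℕ} {q c B : ℝ} (hp : 1 ≤ p) (hq : 0 < q) {x y z : ℝ} (hx0 : 0 < x)
    (hxy : x < y) (hyz : y < z) (hx : radial p c q (-1) B x = 0) (hy : radial p c q (-1) B y = 0)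
    (hz : radial p c q (-1) B z = 0) : False := by
  obtain ⟨u, hu1, hu2, hu⟩ := radial_rolle p c q (-1) B hx0 hxy hx hy
  obtain ⟨v, hv1, hv2, hv⟩ := radial_rolle p c q (-1) B (hx0.trans hxy) hyz hy hz
  have hu0 : 0 < u := hx0.trans hu1
  have huv : u < v := hu2.trans hv1
  have hp' : (1 : ℝ) ≤ p := by exact_mod_cast hp
  have hpow : u ^ (p + 3) < v ^ (p + 3) := pow_lt_pow_left₀ huv hu0.le (by lia)
  have huv0 : 0 < u * v := mul_pos hu0 (hu0.trans huv)
  have h1 := mul_pos (mul_pos hq huv0) (sub_pos.2 hpow)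
  have h2 : 0 < p * (2 * p + 3) * (u * v) * (v - u) := by
    have := sub_pos.2 huv
    positivity
  have h3 : 0 < ((p : ℝ) + 2) * p * (v - u) := by
    have := sub_pos.2 huv
    positivity
  have h4 : 2 * (q * (u * v) * (v ^ (p + 3) - u ^ (p + 3))) + p * (2 * p + 3) * (u * v) * (v - u) +
      (p + 2) * p * (v - u) = 0 := by
    linear_combination v * hu - u * hv
  linarith


theorem radial_no_four {p : ℕ} {q c B : ℝ} (hp : 1 ≤ p) (hq : 0 < q) {x y z w : ℝ} (hx0 : 0 < x)
    (hxy : x < y) (hyz : y < z) (hzw : z < w) (hx : radial p c q 1 B x = 0)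
    (hy : radial p c q 1 B y = 0) (hz : radial p c q 1 B z = 0) (hw : radial p c q 1 B w = 0) :
    False := by
  obtain ⟨u, hu1, hu2, hu⟩ := radial_rolle p c q 1 B hx0 hxy hx hy
  obtain ⟨v, hv1, hv2, hv⟩ := radial_rolle p c q 1 B (hx0.trans hxy) hyz hy hz
  obtain ⟨t, ht1, ht2, ht⟩ := radial_rolle p c q 1 B (hx0.trans (hxy.trans hyz)) hzw hz hw
  have hu0 : 0 < u := hx0.trans hu1
  have huv : u < v := hu2.trans hv1
  have hvt : v < t := hv2.trans ht1
  have hp' : (1 : ℝ) ≤ p := by exact_mod_cast hp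
  have hv0 := hu0.trans huv
  have ht0 := hv0.trans hvt
  have key : ∀ r : ℝ, 0 < r → 2 * 1 * q * r ^ (p + 4) + (p + 2) * p + (p + 1) * B * r -
      p * (2 * p + 3) * r ^ 2 = 0 →
      2 * q * r ^ (p + 3) + (p + 2) * p * r⁻¹ = p * (2 * p + 3) * r - (p + 1) * B := by
    intro r hr h
    field_simp
    linear_combination h
  have hu' := key u hu0 hu
  have hv' := key v hv0 hv
  have ht' := key t ht0 ht
  have hcu : StrictConvexOn ℝ (Set.Ioi 0) fun r : ℝ => r ^ (p + 3) :=
    (strictConvexOn_pow (by lia)).subset Set.Ioi_subset_Ici_self (convex_Ioi 0)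
  have hci : ConvexOn ℝ (Set.Ioi 0) fun r : ℝ => r⁻¹ := by
    simpa using convexOn_zpow (𝕜 := ℝ) (-1)
  have h1 := hcu.slope_strict_mono_adjacent hu0 ht0 huv hvt
  have h2 := hci.slope_mono_adjacent hu0 ht0 huv hvt
  have h3 : (0 : ℝ) ≤ (p + 2) * p := by positivity
  have h4 := mul_lt_mul_of_pos_left h1 (show 0 < 2 * q by linarith)
  have h5 := mul_le_mul_of_nonneg_left h2 h3
  have e1 : 2 * q * ((v ^ (p + 3) - u ^ (p + 3)) / (v - u)) + (p + 2) * p * ((v⁻¹ - u⁻¹) / (v - u)) =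
      p * (2 * p + 3) := by
    rw [← mul_div_assoc, ← mul_div_assoc, ← add_div, div_eq_iff (sub_pos.2 huv).ne']
    linear_combination hv' - hu'
  have e2 : 2 * q * ((t ^ (p + 3) - v ^ (p + 3)) / (t - v)) + (p + 2) * p * ((t⁻¹ - v⁻¹) / (t - v)) =
      p * (2 * p + 3) := by
    rw [← mul_div_assoc, ← mul_div_assoc, ← add_div, div_eq_iff (sub_pos.2 hvt).ne']
    linear_combination ht' - hv'
  linarith


theorem radial_zero {p : ℕ} (hp : 1 ≤ p) (c q σ B : ℝ) : 0 < radial p c q σ B 0 := by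
  simpa [radial] using (by lia : 0 < p)

theorem ncard_radial_neg {p : ℕ} (hp : 1 ≤ p) {δ A B : ℝ} (hδ0 : 0 < δ) (hδ1 : δ ≤ 1)
    (hA : 3 * p + 3 ≤ A) (hB : |B| ≤ p) :
    {r : ℝ | 0 < r ∧ radial p (3 + δ) (A ^ 2)⁻¹ (-1) B r = 0}.ncard = 2 := by
  have hp' : (1 : ℝ) ≤ p := by exact_mod_cast hp
  have hA0 : 0 < A := by linarith
  obtain ⟨hB1, hB2⟩ := abs_le.1 hB
  have hcont := continuous_radial p (3 + δ) (A ^ 2)⁻¹ (-1) B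
  have hone : radial p (3 + δ) (A ^ 2)⁻¹ (-1) B 1 < 0 := by
    have : (A ^ 2)⁻¹ ≤ 1 := inv_le_one_of_one_le₀ (one_le_pow₀ (by linarith))
    simp only [radial, one_pow]
    linarith
  have hlarge : 0 < radial p (3 + δ) (A ^ 2)⁻¹ (-1) B (3 * A) := by
    have h1 : (A ^ 2)⁻¹ * (3 * A) ^ 2 = 9 := by field_simp; norm_num
    have h2 : 3 * A ≤ (3 * A) ^ p := le_self_pow₀ (by linarith) (by lia)
    have h3 : (3 * A) ^ 2 * (9 * p + 9) ≤ (3 * A) ^ (p + 2) := by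
      rw [pow_add, mul_comm]
      gcongr
      linarith
    rw [radial, h1]
    nlinarith [mul_nonneg (sub_nonneg.2 h3) (by linarith : 0 ≤ 6 - δ),
      mul_nonneg hA0.le (by linarith : 0 ≤ B + p), mul_pos hA0 hA0,
      mul_nonneg (mul_nonneg hA0.le hA0.le) (by linarith : 0 ≤ (p : ℝ) - 1),
      mul_nonneg (mul_nonneg hA0.le (by linarith : 0 ≤ A - 1)) (by linarith : 0 ≤ (p : ℝ)),
      mul_nonneg (mul_nonneg (mul_nonneg hA0.le hA0.le) (by linarith : 0 ≤ 1 - δ))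
        (by linarith : 0 ≤ (p : ℝ) + 1)]
  obtain ⟨x, hx0, hx1, hx⟩ := exists_zero_of_pos_of_neg hcont one_pos (radial_zero hp _ _ _ _) hone
  obtain ⟨y, hy0, hy1, hy⟩ := exists_zero_of_neg_of_pos hcont (by linarith) hone hlarge
  exact ncard_eq_two_of_no_three ⟨hx0, hx⟩ ⟨by linarith, hy⟩ (hx1.trans hy0)
    fun a ha b hb d hd hab hbd => radial_no_three hp (by positivity) ha.1 hab hbd ha.2 hb.2 hd.2

theorem radial_two_mul_neg {p : ℕ} (hp : 1 ≤ p) {δ A B : ℝ} (hδ1 : δ ≤ 1)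
    (hA : 1 ≤ A) (hB : B ≤ p) : radial p (3 + δ) (A ^ 2)⁻¹ 1 B (2 * A) < 0 := by
  have hp' : (1 : ℝ) ≤ p := by exact_mod_cast hp
  have hA0 : 0 < A := by linarith
  have h1 : (A ^ 2)⁻¹ * (2 * A) ^ 2 = 4 := by field_simp; norm_num
  have h2 : 0 < (2 * A) ^ (p + 2) := by positivity
  rw [radial, h1]
  nlinarith [mul_nonneg h2.le (sub_nonneg.2 hδ1), mul_nonneg hA0.le (sub_nonneg.2 hB),
    mul_nonneg (mul_nonneg hA0.le (sub_nonneg.2 hA)) (by linarith : 0 ≤ (p : ℝ)),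
    mul_nonneg (sub_nonneg.2 hA) (by linarith : 0 ≤ (p : ℝ)), mul_pos hA0 hA0]

theorem ncard_radial_pos {p : ℕ} (hp : 1 ≤ p) {δ A B : ℝ} (hδ0 : 0 < δ) (hδ1 : δ ≤ 1)
    (hA : 3 * p + 3 ≤ A) (hB1 : -p ≤ B) (hB2 : B ≤ p - δ) :
    {r : ℝ | 0 < r ∧ radial p (3 + δ) (A ^ 2)⁻¹ 1 B r = 0}.ncard = 3 := by
  have hp' : (1 : ℝ) ≤ p := by exact_mod_cast hp
  have hA0 : 0 < A := by linarith
  have hcont := continuous_radial p (3 + δ) (A ^ 2)⁻¹ 1 B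
  have hone : radial p (3 + δ) (A ^ 2)⁻¹ 1 B 1 < 0 := by
    have : 0 < (A ^ 2)⁻¹ := by positivity
    simp only [radial, one_pow]
    linarith
  have hmid : 0 < radial p (3 + δ) (A ^ 2)⁻¹ 1 B (3 * p + 3) := by
    have h1 : (A ^ 2)⁻¹ * (3 * p + 3) ^ 2 ≤ 1 := by
      rw [inv_mul_le_one₀ (by positivity)]
      gcongr
    have h2 : (3 * p + 3 : ℝ) ≤ (3 * p + 3) ^ p := le_self_pow₀ (by linarith) (by lia)
    have h3 : (3 * p + 3 : ℝ) ^ 2 * (3 * p + 3) ≤ (3 * p + 3) ^ (p + 2) := by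
      rw [pow_add, mul_comm]
      gcongr
    have h4 : (3 * p + 3 : ℝ) ^ 2 * (3 * p + 3) * 2 ≤
        (3 * p + 3 : ℝ) ^ (p + 2) * (3 + δ - (A ^ 2)⁻¹ * (3 * p + 3) ^ 2) := by
      gcongr
      linarith
    rw [radial]
    nlinarith [mul_nonneg (by linarith : 0 ≤ 3 * (p : ℝ) + 3) (by linarith : 0 ≤ B + p)]
  have hlarge := radial_two_mul_neg hp hδ1 (by linarith : 1 ≤ A) (by linarith : B ≤ p)
  obtain ⟨x, hx0, hx1, hx⟩ := exists_zero_of_pos_of_neg hcont one_pos (radial_zero hp _ _ _ _) hone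
  obtain ⟨y, hy0, hy1, hy⟩ := exists_zero_of_neg_of_pos hcont (by linarith) hone hmid
  obtain ⟨z, hz0, hz1, hz⟩ := exists_zero_of_pos_of_neg hcont (by linarith) hmid hlarge
  exact ncard_eq_three_of_no_four ⟨hx0, hx⟩ ⟨by linarith, hy⟩ ⟨by linarith, hz⟩
    (hx1.trans hy0) (hy1.trans hz0) fun a ha b hb d hd e he hab hbd hde =>
    radial_no_four hp (by positivity) ha.1 hab hbd hde ha.2 hb.2 hd.2 he.2

theorem ncard_radial_special {p : ℕ} (hp : 1 ≤ p) {δ A : ℝ} (hδ0 : 0 < δ) (hδ1 : δ ≤ 1)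
    (hA : 1 ≤ A) (hAδ : p * (2 * p + 3) < A * δ ^ 2) :
    {r : ℝ | 0 < r ∧ radial p (3 + δ) (A ^ 2)⁻¹ 1 p r = 0}.ncard = 1 := by
  have hp' : (1 : ℝ) ≤ p := by exact_mod_cast hp
  have hA0 : 0 < A := by linarith
  have hcont := continuous_radial p (3 + δ) (A ^ 2)⁻¹ 1 p
  have hbound : ∀ r : ℝ, 0 < r → radial p (3 + δ) (A ^ 2)⁻¹ 1 p r = 0 →
      δ ≤ (A ^ 2)⁻¹ * r ^ 2 := by
    intro r hr h
    have h1 : 1 + p * (r - 1) ≤ r ^ p := by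
      have := one_add_mul_le_pow (a := r - 1) (by linarith) p
      simpa using this
    have h2 : 0 ≤ 3 * r ^ (p + 2) - (2 * p + 3) * r ^ 2 + p * r + p := by
      have h3 : 3 * r ^ 2 * (1 + p * (r - 1)) ≤ 3 * r ^ 2 * r ^ p := by gcongr
      have h4 : 0 ≤ p * ((r - 1) ^ 2 * (3 * r + 1)) := by positivity
      rw [pow_add]
      linarith
    have h3 : r ^ (p + 2) * (δ - (A ^ 2)⁻¹ * r ^ 2) ≤ 0 := by
      rw [radial] at h
      linarith
    exact sub_nonpos.1 (nonpos_of_mul_nonpos_right h3 (by positivity))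
  obtain ⟨x, hx0, hx1, hx⟩ := exists_zero_of_pos_of_neg hcont (by linarith : 0 < 2 * A)
    (radial_zero hp _ _ _ _) (radial_two_mul_neg hp hδ1 hA le_rfl)
  have hno : ∀ a b : ℝ, 0 < a → a < b → radial p (3 + δ) (A ^ 2)⁻¹ 1 p a = 0 →
      radial p (3 + δ) (A ^ 2)⁻¹ 1 p b = 0 → False := by
    intro a b ha hab h1 h2
    obtain ⟨z, hz1, -, hz⟩ := radial_rolle p _ _ 1 _ ha hab h1 h2
    have hz0 := ha.trans hz1
    have h3 : δ ≤ (A ^ 2)⁻¹ * z ^ 2 := (hbound a ha h1).trans (by gcongr)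
    have h4 : δ * A ^ 2 ≤ z ^ 2 := by
      rwa [inv_mul_eq_div, le_div_iff₀ (by positivity)] at h3
    have h5 : δ * A ≤ z := by
      refine le_of_sq_le_sq ?_ hz0.le
      nlinarith [mul_nonneg (mul_nonneg hδ0.le (sub_nonneg.2 hδ1)) (sq_nonneg A)]
    have h6 : p * (2 * p + 3) < δ * z := by nlinarith
    have h7 : z ≤ z ^ p := le_self_pow₀ (by nlinarith) (by lia)
    have h8 : δ * (z ^ 2 * z) ≤ (A ^ 2)⁻¹ * z ^ 2 * (z ^ 2 * z ^ p) := by gcongr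
    have h9 := mul_pos (sub_pos.2 h6) (pow_pos hz0 2)
    have h10 : 0 < δ * z * z ^ 2 := by positivity
    have h11 : 0 < (p + 2) * p + (p + 1) * (p : ℝ) * z := by positivity
    have h12 : 2 * 1 * (A ^ 2)⁻¹ * z ^ (p + 4) = 2 * ((A ^ 2)⁻¹ * z ^ 2 * (z ^ 2 * z ^ p)) := by
      ring
    linarith
  rw [Set.ncard_eq_one]
  refine ⟨x, Set.eq_singleton_iff_unique_mem.2 ⟨⟨hx0, hx⟩, fun y hy => ?_⟩⟩
  rcases lt_trichotomy y x with h | h | h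
  · exact (hno y x hy.1 h hy.2 hx).elim
  · exact h
  · exact (hno x y hx0 h hx hy.2).elim

/-- A mixed polynomial with many zeros, all of them on the rays spanned by the `2 * (p + 2)`-th
roots of unity. -/
noncomputable def rayPoly (p : ℕ) (c q s : ℝ) (z : ℂ) : ℂ :=
  z ^ (p + 2) * (c - q * (z * conj z)) + p + s * p / 2 * (z + conj z) - (2 * p + 3) * (z * conj z)

theorem isMixed_rayPoly (p : ℕ) (c q s : ℝ) (hq : q ≠ 0) :
    IsMixed (p + 3) 1 (rayPoly p c q s) := by
  refine ⟨fun i j => if j = 0 then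
      (if i = 0 then (p : ℂ) else 0) + (if i = 1 then (s * p / 2 : ℂ) else 0) +
        (if i = p + 2 then (c : ℂ) else 0)
    else
      (if i = 0 then (s * p / 2 : ℂ) else 0) + (if i = 1 then (-(2 * p + 3) : ℂ) else 0) +
        (if i = p + 3 then -(q : ℂ) else 0), by simpa using hq, fun z => ?_⟩
  simp [rayPoly, Finset.sum_range_succ _ 1, add_mul, Finset.sum_add_distrib, ite_mul]
  ring

theorem rayPoly_ofReal_mul (p : ℕ) (c q s r : ℝ) {ω : ℂ} (hω : ‖ω‖ = 1) :
    rayPoly p c q s (r * ω) = ((r ^ (p + 2) * (c - q * r ^ 2) : ℝ) : ℂ) * ω ^ (p + 2) +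
      ((p + s * p * ω.re * r - (2 * p + 3) * r ^ 2 : ℝ) : ℂ) := by
  have h1 : ω * conj ω = 1 := by simp [Complex.mul_conj', hω]
  have h2 : ω + conj ω = 2 * ω.re := by rw [Complex.add_conj]; push_cast; ring
  have h3 : r * ω * conj (r * ω) = (r : ℂ) ^ 2 := by
    rw [map_mul, Complex.conj_ofReal]
    linear_combination (r : ℂ) ^ 2 * h1
  have h4 : r * ω + conj (r * ω) = 2 * ω.re * r := by
    rw [map_mul, Complex.conj_ofReal]
    linear_combination (r : ℂ) * h2
  rw [rayPoly, h3, h4]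
  push_cast
  ring

theorem rayPoly_eq_zero_iff {p : ℕ} (hp : 1 ≤ p) {c q s r : ℝ} (hs0 : 0 ≤ s) (hs1 : s ≤ 1)
    (hq : 0 < q) (hqc : q ≤ c) (hr : 0 < r) {ω : ℂ} (hω : ‖ω‖ = 1) :
    rayPoly p c q s (r * ω) = 0 ↔ (ω ^ (p + 2) = 1 ∨ ω ^ (p + 2) = -1) ∧
      radial p c q (ω ^ (p + 2)).re (s * p * ω.re) r = 0 := by
  have hp' : (1 : ℝ) ≤ p := by exact_mod_cast hp
  rw [rayPoly_ofReal_mul p c q s r hω]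
  set η := ω ^ (p + 2) with hη
  have hη1 : ‖η‖ = 1 := by rw [hη, norm_pow, hω, one_pow]
  rw [Complex.ext_iff]
  simp only [Complex.add_re, Complex.add_im, Complex.re_ofReal_mul, Complex.im_ofReal_mul,
    Complex.ofReal_re, Complex.ofReal_im, Complex.zero_re, Complex.zero_im, add_zero]
  have hrad : radial p c q η.re (s * p * ω.re) r = r ^ (p + 2) * (c - q * r ^ 2) * η.re +
      (p + s * p * ω.re * r - (2 * p + 3) * r ^ 2) := by
    rw [radial]
    ring
  rw [hrad, and_comm]
  refine and_congr_left fun h => ?_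
  constructor
  · intro h0
    have hne : c - q * r ^ 2 ≠ 0 := by
      intro h1
      have h2 : 1 ≤ r := by
        by_contra! h3
        nlinarith [mul_pos hq (mul_pos (sub_pos.2 h3) (by linarith : 0 < 1 + r))]
      have h4 : ω.re ≤ 1 := (Complex.re_le_norm ω).trans hω.le
      have h5 : s * ω.re ≤ 1 := by nlinarith
      have h6 : p * r * (s * ω.re) ≤ p * r * 1 := by gcongr
      rw [h1] at h
      nlinarith [mul_nonneg (by linarith : 0 ≤ (p : ℝ)) (sub_nonneg.2 h2)]
    have him : η.im = 0 := (mul_eq_zero.1 h0).resolve_left (mul_ne_zero (by positivity) hne)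
    have hη2 : η = η.re := Complex.ext rfl (by simp [him])
    rw [hη2, Complex.norm_real, Real.norm_eq_abs] at hη1
    rcases eq_or_eq_neg_of_abs_eq hη1 with h1 | h1
    · left
      rw [hη2, h1, Complex.ofReal_one]
    · right
      rw [hη2, h1, Complex.ofReal_neg, Complex.ofReal_one]
  · rintro (h1 | h1) <;> simp [h1]

theorem card_nthRootsFinset_neg_one (N : ℕ) (hN : N ≠ 0) :
    (Polynomial.nthRootsFinset N (-1 : ℂ)).card = N := by
  have hζ := Complex.isPrimitiveRoot_exp N hN
  classical
  rw [Polynomial.nthRootsFinset, ← Multiset.toFinset_eq (hζ.nthRoots_nodup (by simp)),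
    Finset.card_mk, hζ.card_nthRoots, if_pos (IsAlgClosed.exists_pow_nat_eq _ (by lia))]

theorem realizesZeros_of_radial {p : ℕ} (hp : 1 ≤ p) {c q s : ℝ} (hs0 : 0 ≤ s) (hs1 : s ≤ 1)
    (hq : 0 < q) (hqc : q ≤ c)
    (hneg : ∀ ω : ℂ, ‖ω‖ = 1 → {r : ℝ | 0 < r ∧ radial p c q (-1) (s * p * ω.re) r = 0}.ncard = 2)
    {d : ℕ} (hd : d ≠ 0) (hone : {r : ℝ | 0 < r ∧ radial p c q 1 (s * p) r = 0}.ncard = d)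
    (hpos : ∀ ω : ℂ, ω ^ (p + 2) = 1 → ω ≠ 1 →
      {r : ℝ | 0 < r ∧ radial p c q 1 (s * p * ω.re) r = 0}.ncard = 3) :
    RealizesZeros (p + 3) 1 (5 * p + 7 + d) := by
  classical
  set Wp := Polynomial.nthRootsFinset (p + 2) (1 : ℂ) with hWp
  set Wn := Polynomial.nthRootsFinset (p + 2) (-1 : ℂ) with hWn
  set R : ℂ → Set ℝ := fun ω =>
    {r : ℝ | 0 < r ∧ radial p c q (ω ^ (p + 2)).re (s * p * ω.re) r = 0} with hR
  have hmp : ∀ ω, ω ∈ Wp ↔ ω ^ (p + 2) = 1 := fun ω => Polynomial.mem_nthRootsFinset (by lia) _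
  have hmn : ∀ ω, ω ∈ Wn ↔ ω ^ (p + 2) = -1 := fun ω => Polynomial.mem_nthRootsFinset (by lia) _
  have hm : ∀ ω, ω ∈ Wp ∪ Wn ↔ ω ^ (p + 2) = 1 ∨ ω ^ (p + 2) = -1 := fun ω => by
    rw [Finset.mem_union, hmp, hmn]
  have hnorm : ∀ ω ∈ Wp ∪ Wn, ‖ω‖ = 1 := fun ω h => by
    have : ‖ω ^ (p + 2)‖ = 1 := by rcases (hm ω).1 h with h | h <;> simp [h]
    rw [norm_pow] at this
    exact (pow_eq_one_iff_of_nonneg (norm_nonneg _) (by lia)).1 this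
  have hR1 : (R 1).ncard = d := by simpa [hR] using hone
  have hRp : ∀ ω ∈ Wp, ω ≠ 1 → (R ω).ncard = 3 := fun ω h h1 => by
    have h2 := (hmp ω).1 h
    simpa [hR, h2] using hpos ω h2 h1
  have hRn : ∀ ω ∈ Wn, (R ω).ncard = 2 := fun ω h => by
    have h2 := (hmn ω).1 h
    simpa [hR, h2] using hneg ω (hnorm ω (Finset.mem_union_right _ h))
  have hfin : ∀ ω ∈ Wp ∪ Wn, (R ω).Finite := fun ω h => by
    apply Set.finite_of_ncard_ne_zero
    rcases Finset.mem_union.1 h with h | h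
    · by_cases h1 : ω = 1
      · rwa [h1, hR1]
      · rw [hRp ω h h1]
        decide
    · rw [hRn ω h]
      decide
  have hdisj : Disjoint Wp Wn := by
    rw [Finset.disjoint_left]
    intro ω h1 h2
    rw [hmp] at h1
    rw [hmn, h1] at h2
    norm_num at h2
  have hone_mem : 1 ∈ Wp := by simp [hmp]
  have hcardp : Wp.card = p + 2 :=
    (Complex.isPrimitiveRoot_exp (p + 2) (by lia)).card_nthRootsFinset
  have hsum : ∑ ω ∈ Wp ∪ Wn, (R ω).ncard = 5 * p + 7 + d := by
    rw [Finset.sum_union hdisj, Finset.sum_congr rfl hRn, ← Finset.add_sum_erase _ _ hone_mem, hR1,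
      Finset.sum_congr rfl fun ω h => hRp ω (Finset.mem_of_mem_erase h) (Finset.ne_of_mem_erase h),
      Finset.sum_const, Finset.sum_const, Finset.card_erase_of_mem hone_mem, hcardp,
      card_nthRootsFinset_neg_one _ (by lia), smul_eq_mul, smul_eq_mul]
    lia
  have hset : {z : ℂ | rayPoly p c q s z = 0} =
      {z : ℂ | ∃ ω ∈ Wp ∪ Wn, ∃ r ∈ R ω, z = r * ω} := by
    ext z
    constructor
    · intro hz
      have hz0 : z ≠ 0 := by
        rintro rfl
        have hp0 : p ≠ 0 := by lia
        simp [rayPoly, hp0] at hz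
      have hr : 0 < ‖z‖ := norm_pos_iff.2 hz0
      have hzr : z = ‖z‖ * (z / ‖z‖) := by
        rw [mul_div_cancel₀]
        exact_mod_cast hr.ne'
      have hω : ‖z / ‖z‖‖ = 1 := by
        rw [norm_div, Complex.norm_real, norm_norm, div_self hr.ne']
      rw [Set.mem_ofPred_eq, hzr, rayPoly_eq_zero_iff hp hs0 hs1 hq hqc hr hω, ← hm] at hz
      exact ⟨_, hz.1, _, ⟨hr, hz.2⟩, hzr⟩
    · rintro ⟨ω, hω, r, hr, rfl⟩
      exact (rayPoly_eq_zero_iff hp hs0 hs1 hq hqc hr.1 (hnorm ω hω)).2 ⟨(hm ω).1 hω, hr.2⟩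
  obtain ⟨h1, h2⟩ := ncard_rays (Wp ∪ Wn) hnorm R (fun ω _ r hr => hr.1) hfin
  exact ⟨_, isMixed_rayPoly p c q s hq.ne', hset ▸ h1, by rw [hset, h2, hsum]⟩

theorem abs_mul_re_le (p : ℕ) {ω : ℂ} (hω : ‖ω‖ = 1) : |p * ω.re| ≤ p := by
  rw [abs_mul, Nat.abs_cast]
  exact mul_le_of_le_one_right (Nat.cast_nonneg p) ((Complex.abs_re_le_norm ω).trans hω.le)

theorem realizesZeros_five_mul_sub_five {p : ℕ} (hp : 1 ≤ p) :
    RealizesZeros (p + 3) 1 (5 * p + 10) := by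
  have hp' : (1 : ℝ) ≤ p := by exact_mod_cast hp
  have hA : ((3 * (p : ℝ) + 3) ^ 2)⁻¹ ≤ 1 := inv_le_one_of_one_le₀ (one_le_pow₀ (by linarith))
  have hpos : {r : ℝ | 0 < r ∧ radial p (3 + 1) ((3 * (p : ℝ) + 3) ^ 2)⁻¹ 1 0 r = 0}.ncard = 3 :=
    ncard_radial_pos hp one_pos le_rfl le_rfl (by linarith) (by linarith)
  refine realizesZeros_of_radial hp (c := 3 + 1) (q := ((3 * (p : ℝ) + 3) ^ 2)⁻¹) le_rfl
    zero_le_one (by positivity) (by linarith) (fun ω _ => ?_) three_ne_zero ?_ fun ω _ _ => ?_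
  · rw [zero_mul, zero_mul]
    exact ncard_radial_neg hp one_pos le_rfl le_rfl (by simp)
  · rwa [zero_mul]
  · rwa [zero_mul, zero_mul]

theorem exists_re_le_one_sub {N : ℕ} (hN : 0 < N) :
    ∃ δ : ℝ, 0 < δ ∧ δ ≤ 1 ∧ ∀ ω : ℂ, ω ^ N = 1 → ω ≠ 1 → ω.re ≤ 1 - δ := by
  have key : ∀ T : Finset ℂ, (∀ ω ∈ T, ω.re < 1) →
      ∃ δ : ℝ, 0 < δ ∧ δ ≤ 1 ∧ ∀ ω ∈ T, ω.re ≤ 1 - δ := by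
    intro T
    induction T using Finset.induction_on with
    | empty => exact fun _ => ⟨1, by simp⟩
    | insert a T _ ih =>
      intro h
      obtain ⟨δ, h0, h1, h2⟩ := ih fun ω hω => h ω (Finset.mem_insert_of_mem hω)
      refine ⟨min δ (1 - a.re), lt_min h0 (sub_pos.2 (h a (Finset.mem_insert_self a T))),
        (min_le_left _ _).trans h1, fun ω hω => ?_⟩
      rcases Finset.mem_insert.1 hω with rfl | hω
      · linarith [min_le_right δ (1 - ω.re)]
      · linarith [min_le_left δ (1 - a.re), h2 ω hω]
  obtain ⟨δ, h0, h1, h2⟩ := key ((Polynomial.nthRootsFinset N (1 : ℂ)).erase 1) fun ω hω => by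
    rw [Finset.mem_erase, Polynomial.mem_nthRootsFinset hN] at hω
    have hn := Complex.norm_eq_one_of_pow_eq_one hω.2 hN.ne'
    refine lt_of_le_of_ne ((Complex.re_le_norm ω).trans hn.le) fun h => hω.1 ?_
    have h3 := Complex.sq_norm ω
    rw [hn, Complex.normSq_apply, h] at h3
    exact Complex.ext h (mul_self_eq_zero.1 (by linarith))
  exact ⟨δ, h0, h1, fun ω hω hω1 => h2 ω (Finset.mem_erase.2
    ⟨hω1, (Polynomial.mem_nthRootsFinset hN _).2 hω⟩)⟩

theorem realizesZeros_five_mul_sub_seven {p : ℕ} (hp : 1 ≤ p) :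
    RealizesZeros (p + 3) 1 (5 * p + 8) := by
  obtain ⟨δ, h0, h1, h2⟩ := exists_re_le_one_sub (N := p + 2) (by lia)
  have hp' : (1 : ℝ) ≤ p := by exact_mod_cast hp
  set A : ℝ := 3 * p + 3 + p * (2 * p + 3) / δ ^ 2 with hA
  have hA1 : 3 * p + 3 ≤ A := by
    have : 0 ≤ p * (2 * p + 3) / δ ^ 2 := by positivity
    linarith
  have hA2 : p * (2 * p + 3) < A * δ ^ 2 := by
    rw [hA, add_mul, div_mul_cancel₀ _ (by positivity)]
    have : 0 < (3 * (p : ℝ) + 3) * δ ^ 2 := by positivity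
    linarith
  have hA3 : (A ^ 2)⁻¹ ≤ 1 := inv_le_one_of_one_le₀ (one_le_pow₀ (by linarith))
  refine realizesZeros_of_radial hp (c := 3 + δ) (q := (A ^ 2)⁻¹) zero_le_one le_rfl
    (inv_pos.2 (pow_pos (by linarith) 2)) (by linarith) (fun ω hω => ?_) one_ne_zero ?_
    fun ω hω hω1 => ?_
  · rw [one_mul]
    exact ncard_radial_neg hp h0 h1 hA1 (abs_mul_re_le p hω)
  · rw [one_mul]
    exact ncard_radial_special hp h0 h1 (by linarith) hA2
  · rw [one_mul]
    have hn := Complex.norm_eq_one_of_pow_eq_one hω (by lia)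
    refine ncard_radial_pos hp h0 h1 hA1 (abs_le.1 (abs_mul_re_le p hn)).1 ?_
    nlinarith [h2 ω hω hω1]

theorem realizesZeros_of_le_five_mul {n k : ℕ} (hk1 : 1 ≤ k) (hk : k + 5 ≤ 5 * n)
    (hpar : k % 2 = (n + 1) % 2) : RealizesZeros n 1 k := by
  induction n generalizing k with
  | zero => lia
  | succ n ih =>
    rcases Nat.lt_or_ge k (n + 1) with h | h
    · exact realizesZeros_small hk1 h
    rcases Nat.lt_or_ge (5 * n) (k + 4) with h2 | h2
    · obtain rfl | rfl | ⟨p, rfl⟩ : n = 1 ∨ n = 2 ∨ ∃ p, n = p + 1 + 2 := by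
        rcases n with _ | _ | _ | p
        · lia
        · lia
        · lia
        · exact Or.inr (Or.inr ⟨p, by lia⟩)
      · obtain rfl | rfl : k = 3 ∨ k = 5 := by lia
        · exact realizesZeros_two_one_three
        · exact realizesZeros_two_one_five
      · obtain rfl | rfl : k = 8 ∨ k = 10 := by lia
        · exact realizesZeros_three_one_eight
        · exact realizesZeros_three_one_ten
      · obtain rfl | rfl : k = 5 * (p + 1) + 8 ∨ k = 5 * (p + 1) + 10 := by lia
        · exact realizesZeros_five_mul_sub_seven (by lia)
        · exact realizesZeros_five_mul_sub_five (by lia)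
    · obtain ⟨k, rfl⟩ : ∃ i, k = i + 1 := ⟨k - 1, by lia⟩
      rcases Nat.eq_zero_or_pos k with rfl | hk0
      · exact realizesZeros_small le_rfl (by lia)
      · exact (ih hk0 (by lia) (by lia)).succ_succ

theorem realizesZeros_sub_add {n m j : ℕ} (hm : 1 ≤ m) (hmn : m < n) (hn : 2 ≤ n)
    (hj : j ≤ 2 * n + m - 3) : RealizesZeros n m (n - m + 2 * j) := by
  obtain ⟨k', i, h1, h2, h3, h4, h5⟩ : ∃ k' i, 1 ≤ k' ∧ i ≤ m - 1 ∧ k' + i = n - m + 2 * j ∧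
      k' + 5 ≤ 5 * n ∧ (k' % 2 = (n + 1) % 2 ∨ k' < n) := by
    rcases Nat.lt_or_ge (5 * n) (n - m + 2 * j + 5) with h | h
    · exact ⟨5 * n - 5, n - m + 2 * j + 5 - 5 * n, by lia, by lia, by lia, by lia, by lia⟩
    · rcases Nat.even_or_odd' m with ⟨l, rfl | rfl⟩
      · rcases Nat.lt_or_ge (n - 2 * l + 2 * j) n with h' | h'
        · exact ⟨n - 2 * l + 2 * j, 0, by lia, by lia, by lia, by lia, by lia⟩
        · exact ⟨n - 2 * l + 2 * j - 1, 1, by lia, by lia, by lia, by lia, by lia⟩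
      · exact ⟨n - (2 * l + 1) + 2 * j, 0, by lia, by lia, by lia, by lia, by lia⟩
  have hk : RealizesZeros n 1 k' := by
    rcases h5 with h5 | h5
    · exact realizesZeros_of_le_five_mul h1 h4 h5
    · exact realizesZeros_small h1 h5
  have := hk.add_antiholomorphic h1 (m - 1) i h2
  rwa [Nat.add_sub_cancel' hm, h3] at this

/-- For `n > m ≥ 1`, `n ≥ 2`, every number `k = n - m + 2j` with
`0 ≤ j ≤ 2n + m - 3` is realized as the number of zeros of some mixed polynomial in
`M(n+m; n, m)`, i.e. with coefficients `c(ν,μ)` supported in `{ν ≤ n, μ ≤ m}` and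
`c(n,m) ≠ 0`. -/
theorem stmt_15 (n m : ℕ) (hm : 1 ≤ m) (hmn : m < n) (hn : 2 ≤ n)
    (j : ℕ) (hj : j ≤ 2 * n + m - 3) :
    ∃ c : ℕ × ℕ → ℂ,
      (∀ ν μ : ℕ, (n < ν ∨ m < μ) → c (ν, μ) = 0) ∧
      c (n, m) ≠ 0 ∧
      ({z : ℂ | ∑ ν ∈ Finset.range (n + 1), ∑ μ ∈ Finset.range (m + 1),
          c (ν, μ) * z ^ ν * (starRingEnd ℂ z) ^ μ = 0}).Finite ∧
      ({z : ℂ | ∑ ν ∈ Finset.range (n + 1), ∑ μ ∈ Finset.range (m + 1),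
          c (ν, μ) * z ^ ν * (starRingEnd ℂ z) ^ μ = 0}).ncard = n - m + 2 * j := by
  obtain ⟨f, ⟨c, hc, hf⟩, hfin, hcard⟩ := realizesZeros_sub_add hm hmn hn hj
  have hsum : ∀ z : ℂ, ∑ ν ∈ Finset.range (n + 1), ∑ μ ∈ Finset.range (m + 1),
      (if n < ν ∨ m < μ then 0 else c ν μ) * z ^ ν * (starRingEnd ℂ z) ^ μ = f z := by
    intro z
    rw [hf]
    refine Finset.sum_congr rfl fun ν hν => Finset.sum_congr rfl fun μ hμ => ?_
    rw [Finset.mem_range] at hν hμ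
    rw [if_neg (by lia)]
  refine ⟨fun x => if n < x.1 ∨ m < x.2 then 0 else c x.1 x.2, fun ν μ h => if_pos h, ?_, ?_, ?_⟩
  · simpa using hc
  · simpa only [hsum] using hfin
  · simpa only [hsum] using hcard
end

section
/- Let n ≥ 1 and let T_n denote the n-th Chebyshev polynomial of the first kind over ℝ. There exist real numbers A, B such that for all real a ≥ A and b ≥ B, the set {(x, y) ∈ ℝ × ℝ | y = T_n(x) ∧ x = a · T_n(b·y)} is finite and has exactly n² elements. -/
open Polynomial Polynomial.Chebyshev in
/-- The polynomial whose roots are the first coordinates of the solutions of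
`y = T_n(x)`, `x = a T_n(b y)`. -/
noncomputable def eliminant (n : ℕ) (a b : ℝ) : ℝ[X] :=
  C a * (T ℝ n).comp (C b * T ℝ n) - X

open Polynomial Polynomial.Chebyshev in
lemma eval_eliminant (n : ℕ) (a b x : ℝ) :
    (eliminant n a b).eval x = a * (T ℝ n).eval (b * (T ℝ n).eval x) - x := by
  simp [eliminant]

open Polynomial Polynomial.Chebyshev in
lemma natDegree_eliminant_le {n : ℕ} (hn : 1 ≤ n) (a b : ℝ) :
    (eliminant n a b).natDegree ≤ n ^ 2 := by
  refine (natDegree_sub_le _ _).trans (max_le ?_ ?_)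
  · refine (natDegree_C_mul_le _ _).trans ?_
    rw [natDegree_comp, natDegree_T, Int.natAbs_natCast, sq]
    refine Nat.mul_le_mul_left _ ((natDegree_C_mul_le _ _).trans ?_)
    rw [natDegree_T, Int.natAbs_natCast]
  · rw [natDegree_X]
    exact Nat.one_le_pow _ _ hn

open Polynomial Polynomial.Chebyshev in
lemma eliminant_ne_zero (n : ℕ) {a b : ℝ} (ha : 2 ≤ a) (hb : 1 ≤ b) : eliminant n a b ≠ 0 := by
  intro h
  have h1 := eval_eliminant n a b 1
  have h2 : 1 ≤ (T ℝ n).eval b := by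
    rw [← Real.cosh_arcosh hb, T_real_cosh]
    exact Real.one_le_cosh _
  rw [h, eval_zero, T_eval_one, mul_one] at h1
  nlinarith

/-- For `ψ ∈ [0, π]`, the unique `θ ∈ [iπ/n, (i+1)π/n]` with `b cos (nθ) = cos ψ`. -/
noncomputable def branchAngle (n : ℕ) (b : ℝ) (i : ℕ) (ψ : ℝ) : ℝ :=
  (i * Real.pi + Real.arccos ((-1) ^ i * (Real.cos ψ / b))) / n

lemma continuous_branchAngle (n : ℕ) (b : ℝ) (i : ℕ) : Continuous (branchAngle n b i) := by
  unfold branchAngle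
  fun_prop

lemma abs_neg_one_pow_mul_cos_div_lt_one {b : ℝ} (hb : 2 ≤ b) (i : ℕ) (ψ : ℝ) :
    |(-1) ^ i * (Real.cos ψ / b)| < 1 := by
  rw [abs_mul, abs_neg_one_pow, one_mul, abs_div, div_lt_one (by positivity)]
  have h1 := Real.abs_cos_le_one ψ
  have h2 := le_abs_self b
  linarith

lemma natCast_mul_branchAngle {n : ℕ} (hn : 1 ≤ n) (b : ℝ) (i : ℕ) (ψ : ℝ) :
    n * branchAngle n b i ψ =
      i * Real.pi + Real.arccos ((-1) ^ i * (Real.cos ψ / b)) := by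
  have : (n : ℝ) ≠ 0 := by positivity
  unfold branchAngle
  field_simp

lemma natCast_mul_branchAngle_mem_Ioo {n : ℕ} (hn : 1 ≤ n) {b : ℝ} (hb : 2 ≤ b) (i : ℕ) (ψ : ℝ) :
    n * branchAngle n b i ψ ∈ Set.Ioo (i * Real.pi) ((i + 1) * Real.pi) := by
  rw [natCast_mul_branchAngle hn]
  obtain ⟨h1, h2⟩ := abs_lt.1 (abs_neg_one_pow_mul_cos_div_lt_one hb i ψ)
  have h3 := Real.arccos_pos.2 h2
  have h4 : Real.arccos ((-1) ^ i * (Real.cos ψ / b)) < Real.pi := by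
    refine lt_of_le_of_ne (Real.arccos_le_pi _) fun h => ?_
    rw [Real.arccos_eq_pi] at h
    linarith
  constructor <;> linarith

open Polynomial.Chebyshev in
lemma eval_T_cos_branchAngle {n : ℕ} (hn : 1 ≤ n) {b : ℝ} (hb : 2 ≤ b) (i : ℕ) (ψ : ℝ) :
    (T ℝ n).eval (Real.cos (branchAngle n b i ψ)) = Real.cos ψ / b := by
  obtain ⟨h1, h2⟩ := abs_lt.1 (abs_neg_one_pow_mul_cos_div_lt_one hb i ψ)
  rw [T_real_cos, Int.cast_natCast, natCast_mul_branchAngle hn, add_comm,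
    Real.cos_add_nat_mul_pi, Real.cos_arccos h1.le h2.le, ← mul_assoc, ← mul_pow]
  simp

lemma exists_mul_cos_eq_cos_branchAngle {n : ℕ} (hn : 1 ≤ n) {a : ℝ} (ha : 2 ≤ a) (b : ℝ)
    (i j : ℕ) :
    ∃ ψ : ℝ, n * ψ ∈ Set.Ioo (j * Real.pi) ((j + 1) * Real.pi) ∧
      a * Real.cos (n * ψ) = Real.cos (branchAngle n b i ψ) := by
  have hn0 : (0 : ℝ) < n := by positivity
  have hpi := Real.pi_pos
  let f : ℝ → ℝ := fun ψ => (-1) ^ j * (a * Real.cos (n * ψ) - Real.cos (branchAngle n b i ψ))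
  have hf : Continuous f := by
    have := continuous_branchAngle n b i
    fun_prop
  have hle : j * Real.pi / n ≤ (j + 1) * Real.pi / n := by gcongr; linarith
  have hsq : ((-1 : ℝ) ^ j) * (-1) ^ j = 1 := by rw [← mul_pow]; simp
  have hbound (ψ : ℝ) : |(-1) ^ j * Real.cos (branchAngle n b i ψ)| ≤ 1 := by
    rw [abs_mul, abs_neg_one_pow, one_mul]
    exact Real.abs_cos_le_one _
  have hl : 0 < f (j * Real.pi / n) := by
    have h := (abs_le.1 (hbound (j * Real.pi / n))).2
    have hc : Real.cos (n * (j * Real.pi / n)) = (-1) ^ j := by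
      rw [mul_div_cancel₀ _ hn0.ne', Real.cos_nat_mul_pi]
    simp only [f, hc]
    linear_combination h + ha - a * hsq
  have hr : f ((j + 1) * Real.pi / n) < 0 := by
    have h := (abs_le.1 (hbound ((j + 1) * Real.pi / n))).1
    have hc : Real.cos (n * ((j + 1) * Real.pi / n)) = -(-1) ^ j := by
      rw [mul_div_cancel₀ _ hn0.ne', ← Nat.cast_succ, Real.cos_nat_mul_pi, pow_succ]
      ring
    simp only [f, hc]
    linear_combination h + ha - a * hsq
  obtain ⟨ψ, ⟨h1, h2⟩, h0⟩ := intermediate_value_Ioo' hle hf.continuousOn ⟨hr, hl⟩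
  refine ⟨ψ, ⟨?_, ?_⟩, ?_⟩
  · rwa [div_lt_iff₀' hn0] at h1
  · rwa [lt_div_iff₀' hn0] at h2
  · simpa [f, sub_eq_zero] using h0

lemma natCast_eq_of_mem_Ioo_mul_pi {i j : ℕ} {t : ℝ}
    (hi : t ∈ Set.Ioo (i * Real.pi) ((i + 1) * Real.pi))
    (hj : t ∈ Set.Ioo (j * Real.pi) ((j + 1) * Real.pi)) : i = j := by
  have h1 := lt_of_mul_lt_mul_right (hi.1.trans hj.2) Real.pi_pos.le
  have h2 := lt_of_mul_lt_mul_right (hj.1.trans hi.2) Real.pi_pos.le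
  norm_cast at h1 h2
  omega

lemma mem_Icc_zero_pi_of_mul_mem_Ioo {n i : ℕ} (hi : i < n) {t : ℝ}
    (h : n * t ∈ Set.Ioo (i * Real.pi) ((i + 1) * Real.pi)) : t ∈ Set.Icc 0 Real.pi := by
  have hn0 : (0 : ℝ) < n := by exact_mod_cast (Nat.zero_le i).trans_lt hi
  have hin : (i : ℝ) + 1 ≤ n := by exact_mod_cast hi
  have hpi := Real.pi_pos
  constructor
  · exact (pos_of_mul_pos_right (lt_of_le_of_lt (by positivity) h.1) hn0.le).le
  · exact le_of_mul_le_mul_left (h.2.le.trans (by gcongr)) hn0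

/-- For `n ≥ 1` and the Chebyshev polynomial `T_n` of the first kind, for all
sufficiently large real `a` and `b`, the system `y = T_n(x)`, `x = a T_n(b y)` has exactly
`n²` real solutions. -/
theorem stmt_16 (n : ℕ) (hn : 1 ≤ n) :
    ∃ A B : ℝ, ∀ a b : ℝ, A ≤ a → B ≤ b →
      ({p : ℝ × ℝ | p.2 = (Polynomial.Chebyshev.T ℝ n).eval p.1 ∧
          p.1 = a * (Polynomial.Chebyshev.T ℝ n).eval (b * p.2)}).Finite ∧
      ({p : ℝ × ℝ | p.2 = (Polynomial.Chebyshev.T ℝ n).eval p.1 ∧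
          p.1 = a * (Polynomial.Chebyshev.T ℝ n).eval (b * p.2)}).ncard = n ^ 2 := by
  refine ⟨2, 2, fun a b ha hb => ?_⟩
  set S := {p : ℝ × ℝ | p.2 = (Polynomial.Chebyshev.T ℝ n).eval p.1 ∧
          p.1 = a * (Polynomial.Chebyshev.T ℝ n).eval (b * p.2)}
  have hP := eliminant_ne_zero n ha (one_le_two.trans hb)
  have hmaps : Set.MapsTo Prod.fst S ((eliminant n a b).roots.toFinset : Set ℝ) := by
    rintro p ⟨hy, hx⟩
    rw [Finset.mem_coe, Multiset.mem_toFinset, Polynomial.mem_roots hP, Polynomial.IsRoot,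
      eval_eliminant, sub_eq_zero, ← hy]
    exact hx.symm
  have hinj : Set.InjOn Prod.fst S := by
    rintro ⟨x, y⟩ ⟨h, -⟩ ⟨x', y'⟩ ⟨h', -⟩ (rfl : x = x')
    exact Prod.ext rfl (h.trans h'.symm)
  have hfin : S.Finite := Set.Finite.of_injOn hmaps hinj (Finset.finite_toSet _)
  refine ⟨hfin, le_antisymm ?_ ?_⟩
  · calc S.ncard ≤ ((eliminant n a b).roots.toFinset : Set ℝ).ncard :=
          Set.ncard_le_ncard_of_injOn _ hmaps hinj (Finset.finite_toSet _)
      _ = (eliminant n a b).roots.toFinset.card := Set.ncard_coe_finset _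
      _ ≤ (eliminant n a b).roots.card := Multiset.toFinset_card_le _
      _ ≤ (eliminant n a b).natDegree := Polynomial.card_roots' _
      _ ≤ n ^ 2 := natDegree_eliminant_le hn a b
  · have hb0 : b ≠ 0 := by positivity
    choose ψ hψ hroot using exists_mul_cos_eq_cos_branchAngle hn ha b
    let g : Fin n × Fin n → ℝ × ℝ := fun q =>
      (Real.cos (branchAngle n b q.1 (ψ q.1 q.2)), Real.cos (ψ q.1 q.2) / b)
    have hgS : Set.range g ⊆ S := by
      rintro _ ⟨⟨i, j⟩, rfl⟩
      refine ⟨(eval_T_cos_branchAngle hn hb _ _).symm, ?_⟩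
      simp only [g]
      rw [mul_div_cancel₀ _ hb0, Polynomial.Chebyshev.T_real_cos, Int.cast_natCast, hroot]
    have hg : Function.Injective g := by
      rintro ⟨i, j⟩ ⟨i', j'⟩ h
      obtain ⟨hx, hy⟩ := Prod.ext_iff.1 h
      simp only [g] at hx hy
      have hθ := Real.injOn_cos
        (mem_Icc_zero_pi_of_mul_mem_Ioo i.2 (natCast_mul_branchAngle_mem_Ioo hn hb _ _))
        (mem_Icc_zero_pi_of_mul_mem_Ioo i'.2 (natCast_mul_branchAngle_mem_Ioo hn hb _ _)) hx
      have hψ' := Real.injOn_cos (mem_Icc_zero_pi_of_mul_mem_Ioo j.2 (hψ i j))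
        (mem_Icc_zero_pi_of_mul_mem_Ioo j'.2 (hψ i' j')) ((div_left_inj' hb0).1 hy)
      refine Prod.ext (Fin.ext (natCast_eq_of_mem_Ioo_mul_pi
        (natCast_mul_branchAngle_mem_Ioo hn hb i (ψ i j)) ?_))
        (Fin.ext (natCast_eq_of_mem_Ioo_mul_pi (hψ i j) ?_))
      · rw [hθ]
        exact natCast_mul_branchAngle_mem_Ioo hn hb _ _
      · rw [hψ']
        exact hψ i' j'
    calc n ^ 2 = Nat.card (Fin n × Fin n) := by simp [sq]
      _ = (Set.range g).ncard := by
        rw [← Set.image_univ, Set.ncard_image_of_injective _ hg, Set.ncard_univ]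
      _ ≤ S.ncard := Set.ncard_le_ncard hgS hfin
end
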